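/- arXiv:1611.00216 — 7 statements merged into one kernel-verified Lean document; each statement's English description precedes it below -/
import Mathlib

section
/- Let λ = (a, 1^m) be a hook shape with a ≥ 1 and m ≥ 0. Then for every c ∈ 𝔽_q, P(s_λ ↦ c) = 1/q. In particular P(s_λ ↦ 0) = 1/q. -/
open Finset Classical

/-- The Jacobi–Trudi matrix of a partition with `k` parts `lam 0 ≥ lam 1 ≥ …`,
with respect to a 1-indexed assignment `a : ℕ → F` of values to `h_1, h_2, …`.
The `(i,j)` entry (indices `0`-based) is `a (lam i - i + j)` if that subscript is `≥ 1`,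
is `1` if it is `0`, and is `0` if it is negative. -/
def JTmat (F : Type*) [Field F] (k : ℕ) (lam : ℕ → ℕ) (a : ℕ → F) :
    Matrix (Fin k) (Fin k) F :=
  Matrix.of fun i j =>
    if 1 ≤ (lam i : ℤ) - (i : ℤ) + (j : ℤ) then
      a ((lam i : ℤ) - (i : ℤ) + (j : ℤ)).toNat
    else if (lam i : ℤ) - (i : ℤ) + (j : ℤ) = 0 then 1 else 0

/-- Extend a tuple `b : Fin N → F` to a `1`-indexed assignment `ℕ → F`
(zero outside `{1, …, N}`). -/
def extFin {F : Type*} [Zero F] {N : ℕ} (b : Fin N → F) : ℕ → F :=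
  fun n => if h : 1 ≤ n ∧ n ≤ N then b ⟨n - 1, by omega⟩ else 0

/-- The probability that the Jacobi–Trudi determinant of the partition `lam`
(with `k` parts) equals `c`, when the values of `h_1, …, h_N` are chosen
uniformly at random in `F`. -/
noncomputable def probEq (F : Type*) [Field F] [Fintype F]
    (k : ℕ) (lam : ℕ → ℕ) (N : ℕ) (c : F) : ℚ :=
  ((Finset.univ.filter fun b : Fin N → F =>
      (JTmat F k lam (extFin b)).det = c).card : ℚ) / (Fintype.card F : ℚ) ^ N

/-- `lam` records a partition with `k` (positive, weakly decreasing) parts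
on the indices `0, …, k-1`. -/
def IsPartition (k : ℕ) (lam : ℕ → ℕ) : Prop :=
  (∀ i, i + 1 < k → lam (i + 1) ≤ lam i) ∧ ∀ i, i < k → 1 ≤ lam i

/-- Functions on a finite additive group that translate by `t * u` along a one-parameter
family of directions `t ↦ v t`, with `u ≠ 0`, are equidistributed. -/
theorem card_mul_card_fiber_of_translate {F V : Type*} [Field F] [Fintype F] [AddGroup V]
    [Fintype V] (f : V → F) (v : F → V) (u : F) (hu : u ≠ 0)
    (hf : ∀ x t, f (x + v t) = f x + t * u) (c : F) :
    Fintype.card F * #{x | f x = c} = Fintype.card V := by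
  have key : ∀ c d : F, #{x | f x = d} ≤ #{x | f x = c} := fun c d =>
    Finset.card_le_card_of_injOn (fun x => x + v ((c - d) / u))
      (fun x hx => by
        have hx' : f x = d := by simpa using hx
        simp [hf, hx', hu])
      (add_left_injective _).injOn
  have hsum := Finset.card_eq_sum_card_fiberwise (f := f) (s := Finset.univ)
    (t := Finset.univ) (fun x _ => by simp)
  rw [Finset.card_univ, Finset.sum_congr rfl fun d _ => (key c d).antisymm (key d c)] at hsum
  simpa using hsum.symm

section Hook

variable {F : Type*} [Field F]

theorem extFin_add_single_last {N : ℕ} (b : Fin (N + 1) → F) (t : F) (n : ℕ) :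
    extFin (b + Pi.single (Fin.last N) t) n = extFin b n + if n = N + 1 then t else 0 := by
  unfold extFin
  by_cases h : 1 ≤ n ∧ n ≤ N + 1
  · by_cases hn : n = N + 1
    · subst hn
      simp [Fin.last]
    · have : (⟨n - 1, by omega⟩ : Fin (N + 1)) ≠ Fin.last N := by
        simp only [ne_eq, Fin.ext_iff, Fin.val_last]
        omega
      simp [h, hn, this]
  · have hn : n ≠ N + 1 := by omega
    simp [h, hn]

/-- Changing only `h_{a+m}` changes only the top right entry of the Jacobi–Trudi matrix
of the hook `(a, 1^m)`. -/
theorem JTmat_hook_eq_updateRow {a m : ℕ} (ha : 1 ≤ a) (h h' : ℕ → F) (t : F)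
    (hh : ∀ n, h' n = h n + if n = a + m then t else 0) :
    JTmat F (m + 1) (fun i => if i = 0 then a else 1) h' =
      (JTmat F (m + 1) (fun i => if i = 0 then a else 1) h).updateRow 0
        (JTmat F (m + 1) (fun i => if i = 0 then a else 1) h 0 +
          t • Pi.single (Fin.last m) 1) := by
  ext i j
  have hj := j.isLt
  rcases Fin.eq_zero_or_eq_succ i with rfl | ⟨i, rfl⟩
  · have h1 : 1 ≤ (a : ℤ) + (j : ℕ) := by omega
    have h2 : ((a : ℤ) + (j : ℕ)).toNat = a + j := by omega
    have h3 : a + (j : ℕ) = a + m ↔ j = Fin.last m := by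
      rw [Fin.ext_iff, Fin.val_last]
      omega
    rw [Matrix.updateRow_self, Pi.add_apply, Pi.smul_apply]
    simp only [JTmat, Matrix.of_apply, Fin.val_zero, if_true, Nat.cast_zero, sub_zero, if_pos h1,
      h2, hh, h3, Pi.single_apply, smul_eq_mul, mul_ite, mul_one, mul_zero]
  · have hne : ¬ ((1 : ℤ) - ((i : ℕ) + 1 : ℕ) + (j : ℕ)).toNat = a + m := by omega
    rw [Matrix.updateRow_ne (Fin.succ_ne_zero i)]
    simp only [JTmat, Matrix.of_apply, hh, Fin.val_succ, Nat.succ_ne_zero, if_false,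
      Nat.cast_one, if_neg hne, add_zero]

/-- Deleting the first row and last column of the Jacobi–Trudi matrix of a hook leaves
a unitriangular matrix. -/
theorem det_JTmat_hook_submatrix (a m : ℕ) (h : ℕ → F) :
    ((JTmat F (m + 1) (fun i => if i = 0 then a else 1) h).submatrix
      Fin.succ Fin.castSucc).det = 1 := by
  rw [Matrix.det_of_isUpperTriangular]
  · refine Finset.prod_eq_one fun i _ => ?_
    simp [JTmat]
  · intro i j hij
    have hij' : (j : ℕ) < i := hij
    have h1 : ¬ (1 : ℤ) ≤ 1 - ((i : ℕ) + 1 : ℕ) + (j : ℕ) := by omega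
    have h2 : ¬ (1 : ℤ) - ((i : ℕ) + 1 : ℕ) + (j : ℕ) = 0 := by omega
    simp only [JTmat, Matrix.submatrix_apply, Matrix.of_apply, Fin.val_succ, Fin.val_castSucc,
      Nat.succ_ne_zero, if_false, Nat.cast_one]
    rw [if_neg h1, if_neg h2]

theorem det_JTmat_hook_add {a m : ℕ} (ha : 1 ≤ a) (h h' : ℕ → F) (t : F)
    (hh : ∀ n, h' n = h n + if n = a + m then t else 0) :
    (JTmat F (m + 1) (fun i => if i = 0 then a else 1) h').det =
      (JTmat F (m + 1) (fun i => if i = 0 then a else 1) h).det + t * (-1) ^ m := by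
  rw [JTmat_hook_eq_updateRow ha h h' t hh, Matrix.det_updateRow_add, Matrix.updateRow_eq_self,
    Matrix.det_updateRow_smul, ← Matrix.adjugate_apply,
    Matrix.adjugate_fin_succ_eq_det_submatrix, Fin.succAbove_last]
  have : (Fin.succAbove (0 : Fin (m + 1))) = Fin.succ := funext Fin.zero_succAbove
  rw [this, det_JTmat_hook_submatrix]
  simp

end Hook

/-- For a hook shape `λ = (a, 1^m)`, the Jacobi–Trudi determinant is uniformly
distributed: `P(s_λ ↦ c) = 1/q` for every `c ∈ 𝔽_q`; in particular `P(s_λ ↦ 0) = 1/q`. -/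
theorem hook_prob_uniform (F : Type*) [Field F] [Fintype F]
    (a m : ℕ) (ha : 1 ≤ a) (c : F) :
    probEq F (m + 1) (fun i => if i = 0 then a else 1) (a + m) c =
      1 / (Fintype.card F : ℚ) := by
  obtain ⟨N, hN⟩ : ∃ N, a + m = N + 1 := ⟨a + m - 1, by omega⟩
  have hcard := card_mul_card_fiber_of_translate
    (fun b : Fin (N + 1) → F =>
      (JTmat F (m + 1) (fun i => if i = 0 then a else 1) (extFin b)).det)
    (fun t => Pi.single (Fin.last N) t) ((-1) ^ m) (by simp)
    (fun b t => det_JTmat_hook_add ha _ _ t fun n => by rw [extFin_add_single_last, hN]) c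
  rw [Fintype.card_fun, Fintype.card_fin] at hcard
  have hq : (Fintype.card F : ℚ) ≠ 0 := Nat.cast_ne_zero.mpr Fintype.card_ne_zero
  rw [probEq, hN, div_eq_div_iff (pow_ne_zero _ hq) hq, one_mul, mul_comm]
  exact_mod_cast hcard
end

section
/- For every partition λ, P(s_λ ↦ 0) = P(s_{λ'} ↦ 0), where λ' is the conjugate (transpose) partition of λ. -/
open Finset Classical

/-- The conjugate (transpose) partition: its `j`-th part (here `0`-indexed) is
`#{i < k : lam i ≥ j + 1}`. -/
def conjugate (k : ℕ) (lam : ℕ → ℕ) : ℕ → ℕ :=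
  fun j => ((Finset.range k).filter fun i => j + 1 ≤ lam i).card

/-- A weakly decreasing sequence of parts is antitone on its whole index range. -/
theorem IsPartition.antitone {k : ℕ} {lam : ℕ → ℕ} (h : IsPartition k lam) {i j : ℕ}
    (hij : i ≤ j) (hj : j < k) : lam j ≤ lam i := by
  induction j, hij using Nat.le_induction with
  | base => exact le_rfl
  | succ n _ ih => exact (h.1 n hj).trans (ih (by omega))

theorem lt_conjugate_iff {k : ℕ} {lam : ℕ → ℕ} (h : IsPartition k lam) {i j : ℕ} (hi : i < k) :
    i < conjugate k lam j ↔ j < lam i := by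
  unfold conjugate
  constructor
  · intro hlt
    by_contra! hle
    have hsub : ((range k).filter fun i => j + 1 ≤ lam i) ⊆ range i := by
      intro x hx
      simp only [mem_filter, mem_range] at hx ⊢
      by_contra! hix
      have := h.antitone hix hx.1
      omega
    have := card_le_card hsub
    rw [card_range] at this
    omega
  · intro hlt
    have hsub : range (i + 1) ⊆ ((range k).filter fun i => j + 1 ≤ lam i) := by
      intro x hx
      simp only [mem_filter, mem_range] at hx ⊢
      have := h.antitone (show x ≤ i by omega) hi
      omega
    have := card_le_card hsub
    rw [card_range] at this
    omega

theorem conjugate_le (k : ℕ) (lam : ℕ → ℕ) (j : ℕ) : conjugate k lam j ≤ k :=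
  (card_filter_le _ _).trans_eq (card_range k)

theorem conjugate_antitone (k : ℕ) (lam : ℕ → ℕ) : Antitone (conjugate k lam) := by
  intro i j hij
  refine card_le_card fun x hx => ?_
  simp only [mem_filter, mem_range] at hx ⊢
  omega

theorem IsPartition.conjugate_zero {k : ℕ} {lam : ℕ → ℕ} (h : IsPartition k lam) :
    conjugate k lam 0 = k := by
  unfold conjugate
  rw [filter_true_of_mem fun i hi => h.2 i (mem_range.1 hi), card_range]

/-- The row index of the big Toeplitz matrix attached to a part of `lam` (left summand) or to a
part of its conjugate (right summand). -/
def mayaIndex (k : ℕ) (lam : ℕ → ℕ) : Fin k ⊕ Fin (lam 0) → ℕ :=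
  Sum.elim (fun i => lam 0 - lam i + i) (fun j => lam 0 - 1 - j + conjugate k lam j)

theorem mayaIndex_lt {k : ℕ} {lam : ℕ → ℕ} (x : Fin k ⊕ Fin (lam 0)) :
    mayaIndex k lam x < lam 0 + k := by
  rcases x with i | j
  · simp only [mayaIndex, Sum.elim_inl]
    omega
  · have := conjugate_le k lam j
    simp only [mayaIndex, Sum.elim_inr]
    omega

theorem mayaIndex_injective {k : ℕ} {lam : ℕ → ℕ} (h : IsPartition k lam) :
    Function.Injective (mayaIndex k lam) := by
  have hne (i : Fin k) (j : Fin (lam 0)) :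
      lam 0 - lam i + i ≠ lam 0 - 1 - j + conjugate k lam j := by
    have h0 := h.antitone (Nat.zero_le i) i.2
    have := lt_conjugate_iff h (j := j) i.2
    omega
  rintro (i | j) (i' | j') hx <;> simp only [mayaIndex, Sum.elim_inl, Sum.elim_inr] at hx
  · have h0 := h.antitone (Nat.zero_le i) i.2
    have h0' := h.antitone (Nat.zero_le i') i'.2
    congr 1
    ext
    rcases le_total (i : ℕ) i' with hii | hii
    · have := h.antitone hii i'.2
      omega
    · have := h.antitone hii i.2
      omega
  · exact absurd hx (hne _ _)
  · exact absurd hx.symm (hne _ _)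
  · congr 1
    ext
    rcases le_total (j : ℕ) j' with hjj | hjj
    · have := conjugate_antitone k lam hjj
      omega
    · have := conjugate_antitone k lam hjj
      omega

/-- The two families of row indices together enumerate `0, …, lam 0 + k - 1`. -/
noncomputable def mayaEquiv {k : ℕ} {lam : ℕ → ℕ} (h : IsPartition k lam) :
    Fin k ⊕ Fin (lam 0) ≃ Fin (lam 0 + k) :=
  Equiv.ofBijective (fun x => ⟨mayaIndex k lam x, mayaIndex_lt x⟩) <|
    (Fintype.bijective_iff_injective_and_card _).2
      ⟨fun _ _ hxy => mayaIndex_injective h (Fin.mk.inj hxy), by simp [add_comm]⟩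

/-- The column indices: the last `k` ones, followed by the first `m` ones in reverse order. -/
def columnEquiv (k m : ℕ) : Fin k ⊕ Fin m ≃ Fin (m + k) :=
  (Equiv.sumComm _ _).trans <| (Equiv.sumCongr Fin.revPerm (Equiv.refl _)).trans finSumFinEquiv

/-- For mutually inverse block matrices: if the first block of `A` is singular,
so is the opposite block of its inverse. -/
theorem Matrix.det_toBlocks₂₂_eq_zero {F α β : Type*} [Field F] [Fintype α] [Fintype β]
    [DecidableEq α] [DecidableEq β] {A B : Matrix (α ⊕ β) (α ⊕ β) F} (h : B * A = 1)
    (hA : A.toBlocks₁₁.det = 0) : B.toBlocks₂₂.det = 0 := by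
  obtain ⟨v, hv0, hv⟩ := Matrix.exists_mulVec_eq_zero_iff.2 hA
  rw [← Matrix.fromBlocks_toBlocks A, ← Matrix.fromBlocks_toBlocks B,
    Matrix.fromBlocks_multiply, ← Matrix.fromBlocks_one, Matrix.fromBlocks_inj] at h
  obtain ⟨h11, -, h21, -⟩ := h
  have e1 := congrArg (Matrix.mulVec · v) h11
  have e2 := congrArg (Matrix.mulVec · v) h21
  simp only [Matrix.add_mulVec, ← Matrix.mulVec_mulVec, hv, Matrix.mulVec_zero, zero_add,
    Matrix.one_mulVec, Matrix.zero_mulVec] at e1 e2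
  refine Matrix.exists_mulVec_eq_zero_iff.1 ⟨_, fun h0 => hv0 ?_, e2⟩
  rw [← e1, h0, Matrix.mulVec_zero]

/-- Jacobi's complementary minor theorem, for the vanishing of minors. -/
theorem Matrix.det_toBlocks₁₁_eq_zero_iff {F α β : Type*} [Field F] [Fintype α] [Fintype β]
    [DecidableEq α] [DecidableEq β] {A B : Matrix (α ⊕ β) (α ⊕ β) F} (h : A * B = 1) :
    A.toBlocks₁₁.det = 0 ↔ B.toBlocks₂₂.det = 0 := by
  refine ⟨Matrix.det_toBlocks₂₂_eq_zero (mul_eq_one_comm.1 h), fun hB => ?_⟩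
  have hswap : A.submatrix Sum.swap Sum.swap * B.submatrix Sum.swap Sum.swap = 1 := by
    change A.submatrix (Equiv.sumComm β α) (Equiv.sumComm β α) *
      B.submatrix (Equiv.sumComm β α) (Equiv.sumComm β α) = 1
    rw [Matrix.submatrix_mul_equiv, h, Matrix.submatrix_one_equiv]
  exact Matrix.det_toBlocks₂₂_eq_zero hswap hB

/-- The entries of the upper triangular Toeplitz matrix of a power series. -/
noncomputable def toeplitz {F : Type*} [Field F] (P : PowerSeries F) (r c : ℕ) : F :=
  if r ≤ c then PowerSeries.coeff (c - r) P else 0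

theorem toeplitz_mul {F : Type*} [Field F] (P Q : PowerSeries F) {n r c : ℕ} (hc : c < n) :
    ∑ l ∈ range n, toeplitz P r l * toeplitz Q l c = toeplitz (P * Q) r c := by
  have hsub : Ico r (c + 1) ⊆ range n := fun x hx => by
    simp only [mem_Ico, mem_range] at hx ⊢
    omega
  rw [← sum_subset hsub]
  · by_cases hrc : r ≤ c
    · rw [sum_Ico_eq_sum_range, toeplitz, if_pos hrc, PowerSeries.coeff_mul,
        Nat.sum_antidiagonal_eq_sum_range_succ
          (fun i j => PowerSeries.coeff i P * PowerSeries.coeff j Q),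
        show c + 1 - r = (c - r).succ by omega]
      refine sum_congr rfl fun x hx => ?_
      rw [mem_range] at hx
      rw [toeplitz, toeplitz, if_pos (by omega), if_pos (by omega), Nat.add_sub_cancel_left,
        Nat.sub_sub]
    · rw [Ico_eq_empty (by omega), sum_empty, toeplitz, if_neg hrc]
  · intro x _ hx
    rw [mem_Ico] at hx
    unfold toeplitz
    by_cases hrx : r ≤ x
    · rw [if_neg (show ¬ x ≤ c by omega), mul_zero]
    · rw [if_neg hrx, zero_mul]

/-- The `n × n` upper triangular Toeplitz matrix of a power series. -/
noncomputable def toeplitzMatrix {F : Type*} [Field F] (n : ℕ) (P : PowerSeries F) :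
    Matrix (Fin n) (Fin n) F :=
  Matrix.of fun r c => toeplitz P r c

theorem toeplitzMatrix_mul {F : Type*} [Field F] (n : ℕ) (P Q : PowerSeries F) :
    toeplitzMatrix n P * toeplitzMatrix n Q = toeplitzMatrix n (P * Q) := by
  ext r c
  rw [Matrix.mul_apply]
  simp only [toeplitzMatrix, Matrix.of_apply]
  rw [Fin.sum_univ_eq_sum_range (fun l => toeplitz P r l * toeplitz Q l c) n,
    toeplitz_mul P Q c.2]

theorem toeplitzMatrix_one {F : Type*} [Field F] (n : ℕ) :
    toeplitzMatrix n (1 : PowerSeries F) = 1 := by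
  ext r c
  simp only [toeplitzMatrix, Matrix.of_apply, toeplitz, PowerSeries.coeff_one, Matrix.one_apply,
    Fin.ext_iff]
  split_ifs <;> first | rfl | omega

/-- The generating function `1 + ∑ a n * X ^ n`. -/
noncomputable def genFun {F : Type*} [Field F] (a : ℕ → F) : PowerSeries F :=
  PowerSeries.mk fun n => if n = 0 then 1 else a n

theorem constantCoeff_genFun {F : Type*} [Field F] (a : ℕ → F) :
    PowerSeries.constantCoeff (genFun a) = 1 := by
  rw [← PowerSeries.coeff_zero_eq_constantCoeff_apply, genFun, PowerSeries.coeff_mk, if_pos rfl]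

theorem JTmat_eq_toeplitz {F : Type*} [Field F] {k : ℕ} {lam : ℕ → ℕ} (a : ℕ → F) {i j : Fin k}
    {r c : ℕ} (h : (lam i : ℤ) - (i : ℤ) + (j : ℤ) = c - r) :
    JTmat F k lam a i j = toeplitz (genFun a) r c := by
  simp only [JTmat, Matrix.of_apply, h, toeplitz, genFun, PowerSeries.coeff_mk]
  by_cases hrc : r ≤ c
  · rw [if_pos hrc, show ((c : ℤ) - r).toNat = c - r by omega]
    split_ifs <;> first | rfl | omega
  · rw [if_neg hrc, if_neg (by omega), if_neg (by omega)]

/-- If the generating functions of `a` and `b` are inverse to each other up to degree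
`lam 0 + k - 1`, the Jacobi–Trudi determinants of `lam` at `a` and of its conjugate at `b`
vanish simultaneously. -/
theorem det_JTmat_eq_zero_iff {F : Type*} [Field F] {k : ℕ} {lam : ℕ → ℕ}
    (h : IsPartition k lam) (a b : ℕ → F)
    (hab : ∀ n < lam 0 + k, PowerSeries.coeff n (genFun b) = PowerSeries.coeff n (genFun a)⁻¹) :
    (JTmat F k lam a).det = 0 ↔ (JTmat F (lam 0) (conjugate k lam) b).det = 0 := by
  set A := (toeplitzMatrix (lam 0 + k) (genFun a)).submatrix (mayaEquiv h)
    (columnEquiv k (lam 0)) with hA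
  set B := (toeplitzMatrix (lam 0 + k) (genFun a)⁻¹).submatrix (columnEquiv k (lam 0))
    (mayaEquiv h) with hB
  have hAB : A * B = 1 := by
    rw [hA, hB, Matrix.submatrix_mul_equiv, toeplitzMatrix_mul,
      PowerSeries.mul_inv_cancel _ (by rw [constantCoeff_genFun]; exact one_ne_zero),
      toeplitzMatrix_one, Matrix.submatrix_one_equiv]
  have hA11 : JTmat F k lam a = A.toBlocks₁₁ := by
    ext i j
    have h0 := h.antitone (Nat.zero_le i) i.2
    rw [JTmat_eq_toeplitz a (r := lam 0 - lam i + i) (c := lam 0 + j) (by omega)]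
    simp [hA, Matrix.toBlocks₁₁, toeplitzMatrix, mayaEquiv, mayaIndex, columnEquiv]
  have hB22 : (JTmat F (lam 0) (conjugate k lam) b).transpose = B.toBlocks₂₂ := by
    ext i j
    have hle := conjugate_le k lam j
    have hentry : B.toBlocks₂₂ i j = toeplitz (genFun a)⁻¹ (lam 0 - (i + 1))
        (lam 0 - 1 - j + conjugate k lam j) := by
      simp [hB, Matrix.toBlocks₂₂, toeplitzMatrix, mayaEquiv, mayaIndex, columnEquiv]
    rw [hentry, Matrix.transpose_apply, JTmat_eq_toeplitz b (r := lam 0 - (i + 1))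
      (c := lam 0 - 1 - j + conjugate k lam j) (by omega), toeplitz, hab _ (by omega), toeplitz]
  rw [hA11, Matrix.det_toBlocks₁₁_eq_zero_iff hAB, ← hB22, Matrix.det_transpose]

/-- The coefficients of degrees `1, …, N` of the inverse of the generating function. -/
noncomputable def invCoeffs {F : Type*} [Field F] {N : ℕ} (b : Fin N → F) : Fin N → F :=
  fun i => PowerSeries.coeff (i + 1) (genFun (extFin b))⁻¹

theorem coeff_genFun_invCoeffs {F : Type*} [Field F] {N : ℕ} (b : Fin N → F) {n : ℕ}
    (hn : n ≤ N) : PowerSeries.coeff n (genFun (extFin (invCoeffs b))) =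
      PowerSeries.coeff n (genFun (extFin b))⁻¹ := by
  rcases Nat.eq_zero_or_pos n with rfl | hpos
  · rw [PowerSeries.coeff_zero_eq_constantCoeff_apply,
      PowerSeries.coeff_zero_eq_constantCoeff_apply,
      PowerSeries.constantCoeff_inv, constantCoeff_genFun, constantCoeff_genFun, inv_one]
  · rw [genFun, PowerSeries.coeff_mk, if_neg hpos.ne', extFin, dif_pos ⟨hpos, hn⟩, invCoeffs]
    congr 2
    exact Nat.sub_add_cancel hpos

theorem PowerSeries.coeff_inv_congr {F : Type*} [Field F] {P Q : PowerSeries F} {N : ℕ}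
    (hP : PowerSeries.constantCoeff P ≠ 0) (hQ : PowerSeries.constantCoeff Q ≠ 0)
    (h : ∀ n < N, PowerSeries.coeff n P = PowerSeries.coeff n Q) {n : ℕ} (hn : n < N) :
    PowerSeries.coeff n P⁻¹ = PowerSeries.coeff n Q⁻¹ := by
  have hdvd : (PowerSeries.X : PowerSeries F) ^ N ∣ Q - P :=
    PowerSeries.X_pow_dvd_iff.2 fun m hm => by rw [map_sub, h m hm, sub_self]
  have hinv : P⁻¹ - Q⁻¹ = (Q - P) * (P⁻¹ * Q⁻¹) := by
    have h1 := PowerSeries.mul_inv_cancel P hP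
    have h2 := PowerSeries.mul_inv_cancel Q hQ
    linear_combination Q⁻¹ * h1 - P⁻¹ * h2
  have := PowerSeries.X_pow_dvd_iff.1 (hinv ▸ hdvd.mul_right (P⁻¹ * Q⁻¹)) n hn
  rwa [map_sub, sub_eq_zero] at this

theorem invCoeffs_involutive {F : Type*} [Field F] {N : ℕ} :
    Function.Involutive (invCoeffs : (Fin N → F) → Fin N → F) := by
  intro b
  have hb : PowerSeries.constantCoeff (genFun (extFin b)) ≠ 0 := by
    rw [constantCoeff_genFun]; exact one_ne_zero
  ext i
  rw [invCoeffs, PowerSeries.coeff_inv_congr (Q := (genFun (extFin b))⁻¹) (N := N + 1)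
    (by rw [constantCoeff_genFun]; exact one_ne_zero)
    (by rw [PowerSeries.constantCoeff_inv]; exact inv_ne_zero hb)
    (fun n hn => coeff_genFun_invCoeffs b (by omega)) (by omega)]
  have hinv : ((genFun (extFin b))⁻¹)⁻¹ = genFun (extFin b) := by
    rw [PowerSeries.inv_eq_iff_mul_eq_one
      (by rw [PowerSeries.constantCoeff_inv]; exact inv_ne_zero hb),
      PowerSeries.mul_inv_cancel _ hb]
  rw [hinv, genFun, PowerSeries.coeff_mk, if_neg (Nat.succ_ne_zero _), extFin,
    dif_pos ⟨by omega, by omega⟩]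
  rfl

/-- `P(s_λ ↦ 0) = P(s_{λ'} ↦ 0)` for every partition `λ`, where `λ'` is the
conjugate partition (which has `lam 0` parts). -/
theorem prob_zero_conjugate (F : Type*) [Field F] [Fintype F]
    (k : ℕ) (hk : 0 < k) (lam : ℕ → ℕ) (hpart : IsPartition k lam) :
    probEq F k lam (lam 0 + (k - 1)) 0 =
      probEq F (lam 0) (conjugate k lam) (conjugate k lam 0 + (lam 0 - 1)) 0 := by
  have h0 := hpart.2 0 hk
  rw [hpart.conjugate_zero, show k + (lam 0 - 1) = lam 0 + (k - 1) by omega]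
  unfold probEq
  congr 2
  refine card_equiv invCoeffs_involutive.toPerm fun b => ?_
  simp only [mem_filter, mem_univ, true_and]
  exact det_JTmat_eq_zero_iff hpart _ _ fun n hn => coeff_genFun_invCoeffs b (by omega)
end

section
/- Let λ and μ be hook shapes with |λ| ≠ |μ| (where |λ| denotes the sum of the parts of λ). Then the events that their Jacobi–Trudi determinants vanish are independent; explicitly, P(s_λ ↦ 0 and s_μ ↦ 0) = 1/q² = P(s_λ ↦ 0)·P(s_μ ↦ 0). -/
open Finset Classical

/-- The joint probability that the Jacobi–Trudi determinants of two partitions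
both vanish, with `h_1, …, h_N` chosen uniformly at random. -/
noncomputable def probJoint2 (F : Type*) [Field F] [Fintype F]
    (k1 : ℕ) (lam1 : ℕ → ℕ) (k2 : ℕ) (lam2 : ℕ → ℕ) (N : ℕ) : ℚ :=
  ((Finset.univ.filter fun b : Fin N → F =>
      (JTmat F k1 lam1 (extFin b)).det = 0 ∧ (JTmat F k2 lam2 (extFin b)).det = 0).card : ℚ) /
    (Fintype.card F : ℚ) ^ N

/-- Changing one value of an assignment that comes from a tuple is updating that tuple. -/
lemma extFin_update {F : Type*} [Zero F] {N : ℕ} (b : Fin N → F) (i : Fin N) (x : F) :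
    extFin (Function.update b i x) = Function.update (extFin b) (i + 1) x := by
  funext n
  by_cases hn : n = i + 1
  · subst hn
    have h : 1 ≤ (i : ℕ) + 1 ∧ (i : ℕ) + 1 ≤ N := ⟨by omega, by omega⟩
    simp [extFin]
  · rw [Function.update_of_ne hn]
    unfold extFin
    split_ifs with h
    · rw [Function.update_of_ne]
      intro h'
      have := congrArg Fin.val h'
      simp only at this
      omega
    · rfl

/-- The Jacobi–Trudi matrix of the hook `(a, 1^m)` ignores the values beyond index `a + m`. -/
lemma JTmat_hook_update_of_lt (F : Type*) [Field F] (a m n : ℕ) (ha : 1 ≤ a) (hn : a + m < n)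
    (f : ℕ → F) (x : F) :
    JTmat F (m + 1) (fun i => if i = 0 then a else 1) (Function.update f n x) =
      JTmat F (m + 1) (fun i => if i = 0 then a else 1) f := by
  ext i j
  have hj := j.isLt
  simp only [JTmat, Matrix.of_apply]
  congr 1
  apply Function.update_of_ne
  split_ifs <;> omega

/-- Only the top right entry of the Jacobi–Trudi matrix of the hook `(a, 1^m)` involves the
value at `a + m`. -/
lemma JTmat_hook_update (F : Type*) [Field F] (a m : ℕ) (ha : 1 ≤ a) (f : ℕ → F) (x : F) :
    JTmat F (m + 1) (fun i => if i = 0 then a else 1) (Function.update f (a + m) x) =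
      (JTmat F (m + 1) (fun i => if i = 0 then a else 1) f).updateRow 0
        (JTmat F (m + 1) (fun i => if i = 0 then a else 1) f 0 +
          (x - f (a + m)) • Pi.single (Fin.last m) 1) := by
  ext i j
  have hj := j.isLt
  by_cases hi : i = 0
  · subst hi
    rw [Matrix.updateRow_self]
    by_cases hjm : j = Fin.last m
    · subst hjm
      have h : 1 ≤ (a : ℤ) + m := by omega
      have h' : ((a : ℤ) + m).toNat = a + m := by omega
      simp [JTmat, h, h']
    · have hjm' : (j : ℕ) ≠ m := fun h => hjm (Fin.ext h)
      have h' : ((a : ℤ) + j).toNat ≠ a + m := by omega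
      simp [JTmat, hjm, Function.update_of_ne h']
  · have hi' : (i : ℕ) ≠ 0 := fun h => hi (Fin.ext h)
    rw [Matrix.updateRow_ne hi]
    simp only [JTmat, Matrix.of_apply]
    congr 1
    apply Function.update_of_ne
    rw [if_neg hi']
    omega

/-- The minor of the top right entry of the Jacobi–Trudi matrix of a hook is `1`. -/
lemma det_submatrix_JTmat_hook (F : Type*) [Field F] (a m : ℕ) (f : ℕ → F) :
    ((JTmat F (m + 1) (fun i => if i = 0 then a else 1) f).submatrix
      (Fin.succAbove 0) (Fin.succAbove (Fin.last m))).det = 1 := by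
  rw [Matrix.det_of_isUpperTriangular]
  · apply Finset.prod_eq_one
    intro i _
    simp [JTmat]
  · intro i j hij
    have hij' : (j : ℕ) < i := hij
    simp only [JTmat, Matrix.submatrix_apply, Matrix.of_apply, Fin.succAbove_zero,
      Fin.succAbove_last, Fin.val_succ, Fin.val_castSucc]
    rw [if_neg (by simp; omega), if_neg (by simp; omega)]

/-- The Jacobi–Trudi determinant of the hook `(a, 1^m)` is affine in the value at `a + m`, with
leading coefficient `(-1)^m`. -/
lemma det_JTmat_hook_update (F : Type*) [Field F] (a m : ℕ) (ha : 1 ≤ a) (f : ℕ → F) (x : F) :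
    (JTmat F (m + 1) (fun i => if i = 0 then a else 1) (Function.update f (a + m) x)).det =
      (JTmat F (m + 1) (fun i => if i = 0 then a else 1) f).det +
        (x - f (a + m)) * (-1) ^ m := by
  rw [JTmat_hook_update F a m ha, Matrix.det_updateRow_add, Matrix.det_updateRow_smul,
    Matrix.updateRow_eq_self, ← Matrix.adjugate_apply,
    Matrix.adjugate_fin_succ_eq_det_submatrix, det_submatrix_JTmat_hook]
  simp

/-- If `P` ignores coordinate `i` and `D` is affine in coordinate `i` with nonzero slope, then
a proportion `1/q` of the tuples satisfying `P` are zeros of `D`. -/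
lemma card_mul_card_filter_and_eq_zero {F ι : Type*} [Field F] [Fintype F] [Fintype ι]
    [DecidableEq ι]
    (i : ι) (P : (ι → F) → Prop) (D : (ι → F) → F) (c : F) (hc : c ≠ 0)
    (hP : ∀ b x, P (Function.update b i x) ↔ P b)
    (hD : ∀ b x, D (Function.update b i x) = D b + (x - b i) * c) :
    (Finset.univ.filter fun b : ι → F => P b ∧ D b = 0).card * Fintype.card F =
      (Finset.univ.filter P).card := by
  rw [← Finset.card_univ, ← Finset.card_product]
  refine Finset.card_bij' (fun p _ => Function.update p.1 i p.2)
    (fun b _ => (Function.update b i (b i - D b / c), b i)) ?_ ?_ ?_ ?_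
  · rintro ⟨b, x⟩ h
    simp only [Finset.mem_product, Finset.mem_filter, Finset.mem_univ, true_and, and_true] at h
    simpa [hP] using h.1
  · intro b h
    simp only [Finset.mem_filter, Finset.mem_univ, true_and] at h
    simp only [Finset.mem_product, Finset.mem_filter, Finset.mem_univ, true_and, and_true, hP, hD]
    refine ⟨h, ?_⟩
    field_simp
    ring
  · rintro ⟨b, x⟩ h
    simp only [Finset.mem_product, Finset.mem_filter, Finset.mem_univ, true_and, and_true] at h
    have h' : x - (D b + (x - b i) * c) / c = b i := by
      rw [h.2]
      field_simp
      ring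
    simp [hD, h']
  · intro b _
    simp

/-- For `N ≥ a + m`, a tuple is a zero of the Jacobi–Trudi determinant of the hook `(a, 1^m)` with
conditional probability `1/q` given any event that ignores the value at `a + m`. -/
lemma card_mul_card_filter_hook (F : Type*) [Field F] [Fintype F] (a m N : ℕ) (ha : 1 ≤ a)
    (hN : a + m ≤ N) (P : (Fin N → F) → Prop)
    (hP : ∀ b x, P (Function.update b ⟨a + m - 1, by omega⟩ x) ↔ P b) :
    (Finset.univ.filter fun b : Fin N → F => P b ∧
      (JTmat F (m + 1) (fun i => if i = 0 then a else 1) (extFin b)).det = 0).card *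
        Fintype.card F = (Finset.univ.filter P).card := by
  refine card_mul_card_filter_and_eq_zero ⟨a + m - 1, by omega⟩ P
    (fun b => (JTmat F (m + 1) (fun i => if i = 0 then a else 1) (extFin b)).det) ((-1) ^ m)
    (by simp) hP fun b x => ?_
  have h : a + m - 1 + 1 = a + m := by omega
  have hb : extFin b (a + m) = b ⟨a + m - 1, by omega⟩ := by
    rw [extFin, dif_pos ⟨by omega, hN⟩]
  simp only [extFin_update, h, det_JTmat_hook_update F a m ha, hb]

lemma card_filter_hook_mul_card (F : Type*) [Field F] [Fintype F] (a m N : ℕ) (ha : 1 ≤ a)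
    (hN : a + m ≤ N) :
    (Finset.univ.filter fun b : Fin N → F =>
      (JTmat F (m + 1) (fun i => if i = 0 then a else 1) (extFin b)).det = 0).card *
        Fintype.card F = Fintype.card F ^ N := by
  simpa using card_mul_card_filter_hook F a m N ha hN (fun _ => True) (by simp)

/-- The Jacobi–Trudi determinant of a hook vanishes with probability `1/q`. -/
lemma probEq_hook (F : Type*) [Field F] [Fintype F] (a m : ℕ) (ha : 1 ≤ a) :
    probEq F (m + 1) (fun i => if i = 0 then a else 1) (a + m) (0 : F) =
      1 / (Fintype.card F : ℚ) := by
  have hq : (Fintype.card F : ℚ) ≠ 0 := by exact_mod_cast Fintype.card_ne_zero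
  rw [probEq, div_eq_div_iff (pow_ne_zero _ hq) hq, one_mul]
  exact_mod_cast card_filter_hook_mul_card F a m (a + m) ha le_rfl

lemma probJoint2_comm (F : Type*) [Field F] [Fintype F] (k l : ℕ) (lam mu : ℕ → ℕ) (N : ℕ) :
    probJoint2 F k lam l mu N = probJoint2 F l mu k lam N := by
  simp only [probJoint2, and_comm]

lemma probJoint2_hook_of_lt (F : Type*) [Field F] [Fintype F] (a m a' m' : ℕ) (ha : 1 ≤ a)
    (ha' : 1 ≤ a') (hlt : a + m < a' + m') :
    probJoint2 F (m + 1) (fun i => if i = 0 then a else 1)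
        (m' + 1) (fun i => if i = 0 then a' else 1) (a' + m') =
      1 / (Fintype.card F : ℚ) ^ 2 := by
  have hq : (Fintype.card F : ℚ) ≠ 0 := by exact_mod_cast Fintype.card_ne_zero
  have h₁ := card_filter_hook_mul_card F a m (a' + m') ha hlt.le
  have h₂ := card_mul_card_filter_hook F a' m' (a' + m') ha' le_rfl
    (fun b => (JTmat F (m + 1) (fun i => if i = 0 then a else 1) (extFin b)).det = 0)
    fun b x => by
      rw [extFin_update, JTmat_hook_update_of_lt F a m _ ha (by simp only; omega)]
  rw [← h₂, mul_assoc, ← sq] at h₁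
  rw [probJoint2, div_eq_div_iff (pow_ne_zero _ hq) (pow_ne_zero _ hq), one_mul]
  exact_mod_cast h₁

/-- For hooks `λ = (a, 1^m)` and `μ = (a', 1^{m'})` of different sizes, the vanishing
events are independent: the joint probability equals `1/q²`, which is the product of
the individual probabilities. -/
theorem hooks_vanishing_independent (F : Type*) [Field F] [Fintype F]
    (a m a' m' : ℕ) (ha : 1 ≤ a) (ha' : 1 ≤ a') (hne : a + m ≠ a' + m') :
    probJoint2 F (m + 1) (fun i => if i = 0 then a else 1)
        (m' + 1) (fun i => if i = 0 then a' else 1) (max (a + m) (a' + m')) =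
      1 / (Fintype.card F : ℚ) ^ 2 ∧
    probJoint2 F (m + 1) (fun i => if i = 0 then a else 1)
        (m' + 1) (fun i => if i = 0 then a' else 1) (max (a + m) (a' + m')) =
      probEq F (m + 1) (fun i => if i = 0 then a else 1) (a + m) (0 : F) *
        probEq F (m' + 1) (fun i => if i = 0 then a' else 1) (a' + m') (0 : F) := by
  have hjoint : probJoint2 F (m + 1) (fun i => if i = 0 then a else 1)
      (m' + 1) (fun i => if i = 0 then a' else 1) (max (a + m) (a' + m')) =
        1 / (Fintype.card F : ℚ) ^ 2 := by
    rcases lt_or_gt_of_ne hne with h | h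
    · rw [max_eq_right h.le]
      exact probJoint2_hook_of_lt F a m a' m' ha ha' h
    · rw [max_eq_left h.le, probJoint2_comm]
      exact probJoint2_hook_of_lt F a' m' a m ha' ha h
  refine ⟨hjoint, ?_⟩
  rw [hjoint, probEq_hook F a m ha, probEq_hook F a' m' ha']
  ring
end

section
/- Let N ≥ 1 and for each 1 ≤ n ≤ N let λ⁽ⁿ⁾ be a hook shape with |λ⁽ⁿ⁾| = n, and let D_n ∈ ℤ[x_1,…,x_N] be the Jacobi–Trudi determinant polynomial of λ⁽ⁿ⁾. Then the polynomials D_1, …, D_N are algebraically independent over ℤ and the ℤ-subalgebra of ℤ[x_1,…,x_N] they generate is all of ℤ[x_1,…,x_N]. -/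
open Finset Classical

/-- The Jacobi–Trudi matrix of a partition with `k` parts, as a matrix of
polynomials: the `(i,j)` entry (`0`-indexed) is the variable `x_{lam i - i + j}`
if that subscript is `≥ 1`, is `1` if it is `0`, and is `0` if it is negative. -/
noncomputable def JTpoly (k : ℕ) (lam : ℕ → ℕ) :
    Matrix (Fin k) (Fin k) (MvPolynomial ℕ ℤ) :=
  Matrix.of fun i j =>
    if 1 ≤ (lam i : ℤ) - (i : ℤ) + (j : ℤ) then
      MvPolynomial.X ((lam i : ℤ) - (i : ℤ) + (j : ℤ)).toNat
    else if (lam i : ℤ) - (i : ℤ) + (j : ℤ) = 0 then 1 else 0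

/-- A surjective endomorphism of a commutative Noetherian ring is injective. -/
theorem RingHom.injective_of_surjective_endomorphism_of_isNoetherianRing {R : Type*} [CommRing R]
    [IsNoetherianRing R] (f : R →+* R) (hf : Function.Surjective f) : Function.Injective f := by
  have hmono : Monotone fun n : ℕ => RingHom.ker (f ^ n) :=
    monotone_nat_of_le_succ fun n x hx => by
      rw [RingHom.mem_ker] at hx ⊢
      rw [pow_succ', RingHom.mul_def, RingHom.comp_apply, hx, map_zero]
  obtain ⟨n, hn⟩ := monotone_stabilizes_iff_noetherian.2 ‹IsNoetherianRing R› ⟨_, hmono⟩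
  have hker : RingHom.ker (f ^ n) = RingHom.ker (f ^ (n + 1)) := hn (n + 1) n.le_succ
  rw [injective_iff_map_eq_zero]
  intro x hx
  obtain ⟨y, rfl⟩ : ∃ y, (f ^ n) y = x := by
    rw [RingHom.coe_pow]
    exact hf.iterate n x
  rw [← RingHom.mem_ker, hker, RingHom.mem_ker, pow_succ', RingHom.mul_def, RingHom.comp_apply, hx]

/-- Over a Noetherian ring, a finite family indexed by the same type as an algebraically
independent family and generating the same subalgebra is algebraically independent. -/
theorem AlgebraicIndependent.of_adjoin_range_eq {ι R A : Type*} [Finite ι] [CommRing R]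
    [IsNoetherianRing R] [CommRing A] [Algebra R A] {x y : ι → A} (hx : AlgebraicIndependent R x)
    (h : Algebra.adjoin R (Set.range y) = Algebra.adjoin R (Set.range x)) :
    AlgebraicIndependent R y := by
  have hy : (MvPolynomial.aeval y : MvPolynomial ι R →ₐ[R] A).range =
      Algebra.adjoin R (Set.range x) := by
    rw [← h, Algebra.adjoin_range_eq_range_aeval]
  let e := (Subalgebra.equivOfEq _ _ hy).trans hx.aevalEquiv.symm
  let g : MvPolynomial ι R →ₐ[R] MvPolynomial ι R :=
    e.toAlgHom.comp (MvPolynomial.aeval y).rangeRestrict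
  have hg : Function.Surjective g :=
    e.surjective.comp (MvPolynomial.aeval y).rangeRestrict_surjective
  have hinj : Function.Injective g :=
    RingHom.injective_of_surjective_endomorphism_of_isNoetherianRing g.toRingHom hg
  rw [algebraicIndependent_iff_injective_aeval]
  intro p q hpq
  exact hinj (congrArg e (Subtype.ext hpq))

/-- A unitriangular (up to units) change of generators does not change the generated
subalgebra. -/
theorem Algebra.adjoin_image_Iio_eq_of_sub_units_smul_mem {R A : Type*} [CommRing R] [CommRing A]
    [Algebra R A] {x y : ℕ → A} {N : ℕ}
    (h : ∀ i < N, ∃ u : Rˣ, y i - u • x i ∈ Algebra.adjoin R (x '' Set.Iio i)) :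
    Algebra.adjoin R (y '' Set.Iio N) = Algebra.adjoin R (x '' Set.Iio N) := by
  induction N with
  | zero => simp
  | succ n ih =>
    specialize ih fun i hi => h i (by omega)
    obtain ⟨u, hu⟩ := h n n.lt_succ_self
    have hmono (z : ℕ → A) :
        Algebra.adjoin R (z '' Set.Iio n) ≤ Algebra.adjoin R (z '' Set.Iio (n + 1)) :=
      Algebra.adjoin_mono (Set.image_mono (Set.Iio_subset_Iio n.le_succ))
    have hmem (z : ℕ → A) : z n ∈ Algebra.adjoin R (z '' Set.Iio (n + 1)) :=
      Algebra.subset_adjoin ⟨n, n.lt_succ_self, rfl⟩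
    refine le_antisymm (Algebra.adjoin_le ?_) (Algebra.adjoin_le ?_)
    · rintro _ ⟨i, hi, rfl⟩
      rcases Nat.lt_succ_iff_lt_or_eq.1 hi with hi | rfl
      · exact hmono x (ih ▸ Algebra.subset_adjoin ⟨i, hi, rfl⟩)
      · have := add_mem (hmono x hu) (Subalgebra.smul_mem _ (hmem x) (u : R))
        simpa [Units.smul_def] using this
    · rintro _ ⟨i, hi, rfl⟩
      rcases Nat.lt_succ_iff_lt_or_eq.1 hi with hi | rfl
      · exact hmono y (ih ▸ Algebra.subset_adjoin ⟨i, hi, rfl⟩)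
      · have := Subalgebra.smul_mem _ (sub_mem (hmem y) (hmono y (ih ▸ hu))) ((u⁻¹ : Rˣ) : R)
        simpa [← Units.smul_def] using this

/-- A determinant lies in every subring containing the entries. -/
theorem Matrix.det_mem_of_forall_mem {n A S : Type*} [Fintype n] [DecidableEq n] [CommRing A]
    [SetLike S A] [SubringClass S A] {s : S} {M : Matrix n n A} (h : ∀ i j, M i j ∈ s) :
    M.det ∈ s := by
  rw [Matrix.det_apply']
  exact sum_mem fun σ _ => mul_mem (intCast_mem s _) (prod_mem fun i _ => h _ _)

/-- The determinant polynomial of the hook `(a, 1^m)` is `± x_{a+m}` plus a polynomial in the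
variables of smaller index. -/
theorem det_JTpoly_hook_sub_mem (a m : ℕ) (ha : 1 ≤ a) :
    (JTpoly (m + 1) (fun i => if i = 0 then a else 1)).det -
        (-1) ^ m * MvPolynomial.X (a + m) ∈
      Algebra.adjoin ℤ
        ((fun i : ℕ => (MvPolynomial.X (i + 1) : MvPolynomial ℕ ℤ)) '' Set.Iio (a + m - 1)) := by
  set S := Algebra.adjoin ℤ
    ((fun i : ℕ => (MvPolynomial.X (i + 1) : MvPolynomial ℕ ℤ)) '' Set.Iio (a + m - 1))
  have hX (k : ℕ) (h₁ : 1 ≤ k) (h₂ : k < a + m) : (MvPolynomial.X k : MvPolynomial ℕ ℤ) ∈ S := by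
    refine Algebra.subset_adjoin ⟨k - 1, ?_, ?_⟩
    · simp only [Set.mem_Iio]
      omega
    · simp only [Nat.sub_add_cancel h₁]
  set M := JTpoly (m + 1) (fun i => if i = 0 then a else 1) with hM
  have hzero (j : Fin (m + 1)) : M 0 j = MvPolynomial.X (a + j) := by
    simp only [hM, JTpoly, Matrix.of_apply, Fin.val_zero, if_true]
    rw [if_pos (by omega)]
    congr 1
  have hsucc (i : Fin m) (j : Fin (m + 1)) : M i.succ j =
      if i < (j : ℕ) then MvPolynomial.X (j - i : ℕ) else if (i : ℕ) = j then 1 else 0 := by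
    simp only [hM, JTpoly, Matrix.of_apply, Fin.val_succ, Nat.succ_ne_zero, if_false]
    split_ifs <;> first | rfl | omega | (congr 1; push_cast; omega)
  have hsucc_mem (i : Fin m) (j : Fin (m + 1)) : M i.succ j ∈ S := by
    rw [hsucc]
    split_ifs
    · exact hX _ (by omega) (by omega)
    · exact one_mem S
    · exact zero_mem S
  have hminor : (M.submatrix Fin.succ (Fin.last m).succAbove).det = 1 := by
    rw [Matrix.det_of_isUpperTriangular]
    · exact Finset.prod_eq_one fun i _ => by simp [hsucc]
    · intro i j hij
      have hij : (j : ℕ) < i := hij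
      simp only [Matrix.submatrix_apply, hsucc, Fin.succAbove_last, Fin.val_castSucc]
      rw [if_neg (by omega), if_neg (by omega)]
  rw [Matrix.det_succ_row_zero, Fin.sum_univ_castSucc, hminor, hzero, Fin.val_last, mul_one,
    add_sub_cancel_right]
  refine sum_mem fun j _ => mul_mem (mul_mem (pow_mem (neg_mem (one_mem S)) _) ?_)
    (Matrix.det_mem_of_forall_mem fun i k => hsucc_mem _ _)
  rw [hzero]
  exact hX _ (by omega) (by simp)

/-- If for each `1 ≤ n ≤ N` we pick a hook `λ⁽ⁿ⁾ = (a n, 1^(m n))` of size `n`, then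
the Jacobi–Trudi determinant polynomials `D_1, …, D_N` are algebraically independent
over `ℤ` and generate the polynomial ring `ℤ[x_1, …, x_N]` as a `ℤ`-algebra. -/
theorem hooks_algebraic_basis (N : ℕ) (hN : 1 ≤ N) (a m : ℕ → ℕ)
    (ha : ∀ n, 1 ≤ n → n ≤ N → 1 ≤ a n)
    (hsize : ∀ n, 1 ≤ n → n ≤ N → a n + m n = n) :
    AlgebraicIndependent ℤ (fun n : Fin N =>
      (JTpoly (m ((n : ℕ) + 1) + 1) (fun i => if i = 0 then a ((n : ℕ) + 1) else 1)).det) ∧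
    Algebra.adjoin ℤ (Set.range fun n : Fin N =>
      (JTpoly (m ((n : ℕ) + 1) + 1) (fun i => if i = 0 then a ((n : ℕ) + 1) else 1)).det) =
    Algebra.adjoin ℤ (Set.range fun n : Fin N =>
      (MvPolynomial.X ((n : ℕ) + 1) : MvPolynomial ℕ ℤ)) := by
  have hrange (z : ℕ → MvPolynomial ℕ ℤ) :
      (Set.range fun n : Fin N => z n) = z '' Set.Iio N := by
    ext p
    simp [Fin.exists_iff]
  have hadjoin := Algebra.adjoin_image_Iio_eq_of_sub_units_smul_mem (R := ℤ) (N := N)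
    (x := fun n => (MvPolynomial.X (n + 1) : MvPolynomial ℕ ℤ))
    (y := fun n => (JTpoly (m (n + 1) + 1) (fun i => if i = 0 then a (n + 1) else 1)).det)
    fun n hn => by
      have hmem := det_JTpoly_hook_sub_mem (a (n + 1)) (m (n + 1)) (ha _ (by omega) (by omega))
      rw [hsize _ (by omega) (by omega), Nat.add_sub_cancel] at hmem
      refine ⟨(-1) ^ m (n + 1), ?_⟩
      simpa [Units.smul_def, zsmul_eq_mul] using hmem
  rw [← hrange, ← hrange] at hadjoin
  have hX : AlgebraicIndependent ℤ fun n : Fin N =>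
      (MvPolynomial.X ((n : ℕ) + 1) : MvPolynomial ℕ ℤ) :=
    (MvPolynomial.algebraicIndependent_X ℕ ℤ).comp (fun n : Fin N => (n : ℕ) + 1)
      fun i j hij => Fin.ext (by simpa using hij)
  exact ⟨hX.of_adjoin_range_eq hadjoin, hadjoin⟩
end

section
/- Let λ = (4,4,2,2). Then P(s_λ ↦ 0) = (q⁴ + (q−1)(q²−q)) / q⁵ if 𝔽_q has characteristic 2, and P(s_λ ↦ 0) = (q⁴ + (q−1)(q²−q+1)) / q⁵ if 𝔽_q has odd characteristic. -/
open Finset Classical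

/-- Over a field, `x * (x + c)` has two zeros if `c ≠ 0` and one if `c = 0`. -/
lemma sum_ite_mul_add_eq_zero {F : Type*} [Field F] [Fintype F] (c : F) :
    ∑ x : F, (if x * (x + c) = 0 then (1 : ℚ) else 0) = 2 - if c = 0 then 1 else 0 := by
  have h (x : F) : (if x * (x + c) = 0 then (1 : ℚ) else 0) =
      (if x = 0 then 1 else 0) + (if x = -c then 1 else 0) -
        if x = 0 then (if c = 0 then 1 else 0) else 0 := by
    rcases eq_or_ne x 0 with rfl | hx
    · simp [eq_comm]
    · simp [hx, add_eq_zero_iff_eq_neg]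
  rw [sum_congr rfl fun x _ => h x]
  simp only [sum_sub_distrib, sum_add_distrib, sum_ite_eq', mem_univ, if_true]
  norm_num

/-- The number of solutions of `s * (s + (c - m * A)) = A * D` in `A`, `s`, `D`. -/
lemma sum_ite_mul_add_eq_mul {F : Type*} [Field F] [Fintype F] (c m : F) :
    ∑ A : F, ∑ s : F, ∑ D : F, (if s * (s + (c - m * A)) = A * D then (1 : ℚ) else 0) =
      Fintype.card F * (Fintype.card F + 1) - Fintype.card F * if c = 0 then 1 else 0 := by
  have hne (A : F) (hA : A ≠ 0) :
      ∑ s : F, ∑ D : F, (if s * (s + (c - m * A)) = A * D then (1 : ℚ) else 0) =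
        Fintype.card F := by
    have h (s D : F) : s * (s + (c - m * A)) = A * D ↔ D = s * (s + (c - m * A)) / A := by
      rw [eq_div_iff hA, mul_comm D, eq_comm]
    simp [h]
  rw [← add_sum_erase univ _ (mem_univ (0 : F)),
    sum_congr rfl fun A hA => hne A (ne_of_mem_erase hA)]
  have hz : ∑ s : F, ∑ D : F, (if s * (s + (c - m * 0)) = 0 * D then (1 : ℚ) else 0) =
      Fintype.card F * (2 - if c = 0 then 1 else 0) := by
    rw [← sum_ite_mul_add_eq_zero c, mul_sum]
    refine sum_congr rfl fun s _ => ?_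
    simp only [mul_zero, sub_zero, zero_mul, sum_const, card_univ, nsmul_eq_mul]
  rw [hz, sum_const, card_erase_of_mem (mem_univ _), card_univ, nsmul_eq_mul,
    Nat.cast_pred Fintype.card_pos]
  ring

/-- The number of zeros of `x * (x ^ 2 - 2 * y)`. -/
lemma sum_ite_cubic_eq_zero (F : Type*) [Field F] [Fintype F] :
    ∑ x : F, ∑ y : F, (if x ^ 3 - 2 * x * y = 0 then (1 : ℚ) else 0) =
      if ringChar F = 2 then (Fintype.card F : ℚ) else 2 * Fintype.card F - 1 := by
  rw [← add_sum_erase univ _ (mem_univ (0 : F))]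
  split_ifs with h2
  · have : CharP F 2 := h2 ▸ ringChar.charP F
    rw [sum_eq_zero fun x hx => sum_eq_zero fun y _ => ?_]
    · simp
    · simp [CharTwo.two_eq_zero, ne_of_mem_erase hx]
  · have two_ne : (2 : F) ≠ 0 := Ring.two_ne_zero h2
    have h (x : F) (hx : x ∈ univ.erase (0 : F)) :
        ∑ y : F, (if x ^ 3 - 2 * x * y = 0 then (1 : ℚ) else 0) = 1 := by
      have hx0 := ne_of_mem_erase hx
      have h (y : F) : x ^ 3 - 2 * x * y = 0 ↔ y = x ^ 2 / 2 := by
        rw [eq_div_iff two_ne, show x ^ 3 - 2 * x * y = x * (x ^ 2 - y * 2) by ring,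
          mul_eq_zero_iff_left hx0, sub_eq_zero, eq_comm]
      simp [h]
    rw [sum_congr rfl h, sum_const, card_erase_of_mem (mem_univ _), card_univ, nsmul_eq_mul,
      Nat.cast_pred Fintype.card_pos]
    simp
    ring

/-- Polynomial change of coordinates on `(h_1, …, h_7)` which brings the Jacobi–Trudi determinant
of `(4,4,2,2)` into the form `s * (s + δ) - A * D`. -/
def coords4422 (F : Type*) [Field F] : F × F × F × F × F × F × F ≃ (Fin 7 → F) where
  toFun := fun (x, y, z, w, A, s, D) =>
    ![x, y, z, w, A - z * (x ^ 2 - y) + w * x, s - z * (x * y - z) + w * y,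
      D - w * (x * y - z) + (A - z * (x ^ 2 - y) + w * x) * y]
  invFun b := (b 0, b 1, b 2, b 3, b 4 + b 2 * (b 0 ^ 2 - b 1) - b 3 * b 0,
    b 5 + b 2 * (b 0 * b 1 - b 2) - b 3 * b 1, b 6 + b 3 * (b 0 * b 1 - b 2) - b 4 * b 1)
  left_inv := by
    rintro ⟨x, y, z, w, A, s, D⟩
    ext <;> simp <;> ring
  right_inv b := by
    ext i
    fin_cases i <;> simp <;> ring

lemma det_JTmat_coords4422 {F : Type*} [Field F] (x y z w A s D : F) :
    (JTmat F 4 (fun i => if i < 2 then 4 else 2)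
        (extFin (coords4422 F (x, y, z, w, A, s, D)))).det =
      s * (s + (z * (z + (x ^ 3 - 2 * x * y)) - x * A)) - A * D := by
  have h : JTmat F 4 (fun i => if i < 2 then 4 else 2)
      (extFin (coords4422 F (x, y, z, w, A, s, D))) =
      !![w, A - z * (x ^ 2 - y) + w * x, s - z * (x * y - z) + w * y,
          D - w * (x * y - z) + (A - z * (x ^ 2 - y) + w * x) * y;
        z, w, A - z * (x ^ 2 - y) + w * x, s - z * (x * y - z) + w * y;
        1, x, y, z;
        0, 1, x, y] := by
    ext i j
    fin_cases i <;> fin_cases j <;> simp [JTmat, extFin] <;> rfl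
  rw [h]
  simp [Matrix.det_succ_row_zero, Fin.sum_univ_succ, Fin.succAbove]
  ring

/-- The number of zeros of the Jacobi–Trudi determinant of `(4,4,2,2)`. -/
lemma card_det_JTmat_4422_eq_zero (F : Type*) [Field F] [Fintype F] :
    ((univ.filter fun b : Fin 7 → F =>
      (JTmat F 4 (fun i => if i < 2 then 4 else 2) (extFin b)).det = 0).card : ℚ) =
      (Fintype.card F : ℚ) ^ 6 + (Fintype.card F : ℚ) ^ 5 - 2 * (Fintype.card F : ℚ) ^ 4 +
        (Fintype.card F : ℚ) ^ 2 * if ringChar F = 2 then (Fintype.card F : ℚ) else 2 * Fintype.card F - 1 := by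
  rw [card_filter, Nat.cast_sum, ← (coords4422 F).sum_comp]
  simp only [Fintype.sum_prod_type, det_JTmat_coords4422, sub_eq_zero, Nat.cast_ite, Nat.cast_one,
    Nat.cast_zero, sum_ite_mul_add_eq_mul, sum_const, card_univ, nsmul_eq_mul]
  simp only [sum_sub_distrib, ← mul_sum, sum_ite_mul_add_eq_zero, sum_ite_cubic_eq_zero,
    sum_const, card_univ, nsmul_eq_mul]
  ring

/-- For `λ = (4,4,2,2)`: `P(s_λ ↦ 0) = (q⁴ + (q−1)(q²−q))/q⁵` in characteristic `2`,
and `P(s_λ ↦ 0) = (q⁴ + (q−1)(q²−q+1))/q⁵` in odd characteristic. -/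
theorem prob_4422 (F : Type*) [Field F] [Fintype F] :
    (ringChar F = 2 →
      probEq F 4 (fun i => if i < 2 then 4 else 2) 7 0 =
        ((Fintype.card F : ℚ) ^ 4 + ((Fintype.card F : ℚ) - 1) *
            ((Fintype.card F : ℚ) ^ 2 - (Fintype.card F : ℚ))) /
          (Fintype.card F : ℚ) ^ 5) ∧
    (ringChar F ≠ 2 →
      probEq F 4 (fun i => if i < 2 then 4 else 2) 7 0 =
        ((Fintype.card F : ℚ) ^ 4 + ((Fintype.card F : ℚ) - 1) *
            ((Fintype.card F : ℚ) ^ 2 - (Fintype.card F : ℚ) + 1)) /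
          (Fintype.card F : ℚ) ^ 5) := by
  have hq : (Fintype.card F : ℚ) ≠ 0 := Nat.cast_ne_zero.mpr Fintype.card_ne_zero
  constructor <;> intro h
  all_goals
    rw [probEq, card_det_JTmat_4422_eq_zero]
    simp only [h, if_true, if_false]
    field_simp
    ring
end

section
/- For every rectangular shape λ = (b^m) with b, m ≥ 1, P(s_λ ↦ 0) = 1/q. -/
open Finset Classical

open PowerSeries in
/-- The polynomial with coefficients `v 0, …, v (n - 1)`, as a power series. -/
noncomputable def seriesOf {F : Type*} [Field F] {n : ℕ} (v : Fin n → F) : PowerSeries F :=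
  ∑ k : Fin n, monomial (k : ℕ) (v k)

section SeriesOf

open PowerSeries

variable {F : Type*} [Field F]

lemma coeff_seriesOf {n : ℕ} (v : Fin n → F) (k : ℕ) :
    coeff k (seriesOf v) = if h : k < n then v ⟨k, h⟩ else 0 := by
  simp only [seriesOf, map_sum, coeff_monomial]
  split_ifs with h
  · rw [Finset.sum_eq_single ⟨k, h⟩]
    · simp
    · intro j _ hj
      rw [if_neg]
      rintro rfl
      exact hj rfl
    · simp
  · exact Finset.sum_eq_zero fun j _ => if_neg (by have := j.2; omega)

lemma coeff_seriesOf_of_le {n k : ℕ} (v : Fin n → F) (h : n ≤ k) :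
    coeff k (seriesOf v) = 0 := by
  rw [coeff_seriesOf, dif_neg (by omega)]

lemma coeff_seriesOf_val {n : ℕ} (v : Fin n → F) (k : Fin n) :
    coeff (k : ℕ) (seriesOf v) = v k := by
  rw [coeff_seriesOf, dif_pos k.2]

lemma seriesOf_injective {n : ℕ} : Function.Injective (seriesOf : (Fin n → F) → PowerSeries F) := by
  intro v w h
  funext k
  rw [← coeff_seriesOf_val v k, h, coeff_seriesOf_val]

lemma seriesOf_zero {n : ℕ} : seriesOf (0 : Fin n → F) = 0 := by
  simp [seriesOf]

lemma seriesOf_eq_zero_iff {n : ℕ} {v : Fin n → F} : seriesOf v = 0 ↔ v = 0 := by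
  rw [← seriesOf_zero (n := n), seriesOf_injective.eq_iff]

lemma exists_seriesOf_eq {n : ℕ} {V : PowerSeries F} (hV : ∀ k, n ≤ k → coeff k V = 0) :
    ∃ v : Fin n → F, seriesOf v = V := by
  refine ⟨fun k => coeff (k : ℕ) V, ?_⟩
  ext k
  rw [coeff_seriesOf]
  split_ifs with h
  · rfl
  · exact (hV k (by omega)).symm

lemma seriesOf_cons {n : ℕ} (x : F) (v : Fin n → F) :
    seriesOf (Fin.cons x v : Fin (n + 1) → F) = C x + X * seriesOf v := by
  ext k
  rcases k with _ | k
  · simp [coeff_seriesOf]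
  · rw [map_add, coeff_succ_X_mul, coeff_seriesOf, coeff_seriesOf, coeff_C, if_neg (by omega)]
    simp only [add_lt_add_iff_right, zero_add]
    split_ifs <;> rfl

lemma seriesOf_snoc {n : ℕ} (v : Fin n → F) (x : F) :
    seriesOf (Fin.snoc v x : Fin (n + 1) → F) = seriesOf v + monomial n x := by
  simp [seriesOf, Fin.sum_univ_castSucc]

lemma seriesOf_smul_add {n : ℕ} (c : F) (v w : Fin n → F) :
    seriesOf (c • v + w) = C c * seriesOf v + seriesOf w := by
  ext k
  rw [map_add, coeff_C_mul]
  simp only [coeff_seriesOf]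
  split_ifs <;> simp

lemma coeff_mul_seriesOf {n : ℕ} (H : PowerSeries F) (v : Fin n → F) (k : ℕ) :
    coeff k (H * seriesOf v) = ∑ i : Fin n, if (i : ℕ) ≤ k then coeff (k - i) H * v i else 0 := by
  rw [seriesOf, Finset.mul_sum, map_sum]
  refine Finset.sum_congr rfl fun i _ => ?_
  rw [monomial_eq_C_mul_X_pow, ← mul_assoc, coeff_mul_X_pow', coeff_mul_C]

lemma seriesOf_snoc_zero {n : ℕ} (v : Fin n → F) :
    seriesOf (Fin.snoc v 0 : Fin (n + 1) → F) = seriesOf v := by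
  rw [seriesOf_snoc, map_zero, add_zero]

/-- The power series `1 + h 0 * X + h 1 * X ^ 2 + …`. -/
noncomputable def oneSeriesOf {n : ℕ} (h : Fin n → F) : PowerSeries F :=
  1 + X * seriesOf h

lemma constantCoeff_oneSeriesOf {n : ℕ} (h : Fin n → F) : coeff 0 (oneSeriesOf h) = 1 := by
  simp [oneSeriesOf]

lemma coeff_oneSeriesOf_pos {n k : ℕ} (h : Fin n → F) (hk : 1 ≤ k) :
    coeff k (oneSeriesOf h) = extFin h k := by
  obtain ⟨k, rfl⟩ := Nat.exists_eq_add_of_le' hk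
  rw [oneSeriesOf, map_add, coeff_succ_X_mul, coeff_one, if_neg (by omega), zero_add,
    coeff_seriesOf, extFin]
  by_cases hkn : k < n
  · rw [dif_pos hkn, dif_pos ⟨by omega, by omega⟩]
    rfl
  · rw [dif_neg hkn, dif_neg (by omega)]

lemma oneSeriesOf_snoc {n : ℕ} (h : Fin n → F) (x : F) :
    oneSeriesOf (Fin.snoc h x : Fin (n + 1) → F) = oneSeriesOf h + X ^ (n + 1) * C x := by
  rw [oneSeriesOf, oneSeriesOf, seriesOf_snoc, monomial_eq_C_mul_X_pow]
  ring

end SeriesOf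

lemma sum_fin_succ_eq_sum_snoc {F : Type*} [Fintype F] {n : ℕ} (f : (Fin (n + 1) → F) → ℤ) :
    ∑ h, f h = ∑ h : Fin n → F, ∑ x : F, f (Fin.snoc h x) := by
  rw [← (Fin.snocEquiv fun _ : Fin (n + 1) => F).sum_comp, Fintype.sum_prod_type_right]
  rfl

lemma sum_fin_succ_eq_sum_cons {F : Type*} [Fintype F] {n : ℕ} (f : (Fin (n + 1) → F) → ℤ) :
    ∑ h, f h = ∑ x : F, ∑ h : Fin n → F, f (Fin.cons x h) := by
  rw [← (Fin.consEquiv fun _ : Fin (n + 1) => F).sum_comp, Fintype.sum_prod_type]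
  rfl

section Counting

open PowerSeries

variable {F : Type*} [Field F]

/-- The coefficients of `W` in degrees `b, …, N` vanish. -/
def HasGap (b N : ℕ) (W : PowerSeries F) : Prop :=
  ∀ n, b ≤ n → n ≤ N → coeff n W = 0

lemma coeff_oneSeriesOf_snoc_mul {N n : ℕ} (h : Fin N → F) (x : F) (V : PowerSeries F)
    (hn : n ≤ N) :
    coeff n (oneSeriesOf (Fin.snoc h x : Fin (N + 1) → F) * V) = coeff n (oneSeriesOf h * V) := by
  rw [oneSeriesOf_snoc, add_mul, mul_assoc, map_add, coeff_X_pow_mul', if_neg (by omega), add_zero]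

lemma coeff_oneSeriesOf_snoc_mul_last {N : ℕ} (h : Fin N → F) (x : F) (V : PowerSeries F) :
    coeff (N + 1) (oneSeriesOf (Fin.snoc h x : Fin (N + 1) → F) * V) =
      coeff (N + 1) (oneSeriesOf h * V) + x * coeff 0 V := by
  rw [oneSeriesOf_snoc, add_mul, mul_assoc, map_add, coeff_X_pow_mul', if_pos le_rfl, Nat.sub_self,
    coeff_C_mul]

lemma hasGap_snoc_iff {b N : ℕ} (hb : b ≤ N + 1) (h : Fin N → F) (x : F) (V : PowerSeries F) :
    HasGap b (N + 1) (oneSeriesOf (Fin.snoc h x : Fin (N + 1) → F) * V) ↔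
      HasGap b N (oneSeriesOf h * V) ∧ coeff (N + 1) (oneSeriesOf h * V) + x * coeff 0 V = 0 := by
  rw [← coeff_oneSeriesOf_snoc_mul_last]
  constructor
  · intro H
    exact ⟨fun n h1 h2 => by
      rw [← coeff_oneSeriesOf_snoc_mul h x V h2]; exact H n h1 (by omega), H _ hb le_rfl⟩
  · rintro ⟨H1, H2⟩ n h1 h2
    rcases Nat.lt_or_ge N n with h3 | h3
    · obtain rfl : n = N + 1 := by omega
      exact H2
    · rw [coeff_oneSeriesOf_snoc_mul h x V h3]
      exact H1 n h1 h3

variable [Fintype F]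

/-- The number of `H = 1 + h_1 X + … + h_N X ^ N` such that the coefficients of `H * V` in
degrees `b, …, N` vanish. -/
noncomputable def gapCount (b N : ℕ) (V : PowerSeries F) : ℤ :=
  ∑ h : Fin N → F, if HasGap b N (oneSeriesOf h * V) then 1 else 0

lemma gapCount_succ_of_coeff_zero_ne {b N : ℕ} (hb : b ≤ N + 1) {V : PowerSeries F}
    (hV : coeff 0 V ≠ 0) : gapCount b (N + 1) V = gapCount b N V := by
  rw [gapCount, sum_fin_succ_eq_sum_snoc, gapCount]
  refine Finset.sum_congr rfl fun h _ => ?_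
  simp only [hasGap_snoc_iff hb]
  by_cases H : HasGap b N (oneSeriesOf h * V)
  · simp only [H, true_and, if_true]
    rw [Finset.sum_eq_single (-coeff (N + 1) (oneSeriesOf h * V) / coeff 0 V)]
    · rw [if_pos]
      field_simp
      ring
    · intro x _ hx
      rw [if_neg]
      contrapose! hx
      field_simp
      linear_combination hx
    · simp
  · simp [H]

lemma gapCount_succ_X_mul (b N : ℕ) (V : PowerSeries F) :
    gapCount b (N + 1) (X * V) = Fintype.card F * gapCount (b - 1) N V := by
  rw [gapCount, sum_fin_succ_eq_sum_snoc, gapCount, Finset.mul_sum]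
  refine Finset.sum_congr rfl fun h _ => ?_
  have key (x : F) : HasGap b (N + 1) (oneSeriesOf (Fin.snoc h x : Fin (N + 1) → F) * (X * V)) ↔
      HasGap (b - 1) N (oneSeriesOf h * V) := by
    rw [mul_left_comm]
    constructor
    · intro H n h1 h2
      rw [← coeff_oneSeriesOf_snoc_mul h x V h2, ← coeff_succ_X_mul]
      exact H _ (by omega) (by omega)
    · rintro H (_ | n) h1 h2
      · simp
      · rw [coeff_succ_X_mul, coeff_oneSeriesOf_snoc_mul h x V (by omega)]
        exact H _ (by omega) (by omega)
  simp [key]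

lemma gapCount_succ {b N : ℕ} (hb : b ≤ N + 1) {V : PowerSeries F}
    (hV : ∃ k ≤ N, coeff k V ≠ 0) : gapCount b (N + 1) V = gapCount b N V := by
  induction N generalizing b V with
  | zero =>
    obtain ⟨k, hk, hV⟩ := hV
    obtain rfl : k = 0 := by omega
    exact gapCount_succ_of_coeff_zero_ne hb hV
  | succ N ih =>
    by_cases h0 : coeff 0 V = 0
    · obtain ⟨V, rfl⟩ := X_dvd_iff.mpr (by simpa using h0)
      rw [gapCount_succ_X_mul, gapCount_succ_X_mul, ih (by omega)]
      obtain ⟨_ | k, hk, hV⟩ := hV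
      · exact absurd h0 hV
      · exact ⟨k, by omega, by rwa [coeff_succ_X_mul] at hV⟩
    · exact gapCount_succ_of_coeff_zero_ne hb h0

lemma gapCount_of_coeff_zero_ne (b N : ℕ) {V : PowerSeries F} (hV : coeff 0 V ≠ 0) :
    gapCount (b + 1) (b + N) V = (Fintype.card F : ℤ) ^ b := by
  induction N with
  | zero =>
    have (h : Fin b → F) : HasGap (b + 1) b (oneSeriesOf h * V) := fun n h1 h2 => by omega
    simp [gapCount, this]
  | succ N ih => rw [← add_assoc, gapCount_succ_of_coeff_zero_ne (by omega) hV, ih]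

lemma gapCount_zero (b N : ℕ) : gapCount b N (0 : PowerSeries F) = (Fintype.card F : ℤ) ^ N := by
  have : HasGap b N (0 : PowerSeries F) := fun n _ _ => by simp
  simp [gapCount, this]

/-- The number of polynomials `V` of degree less than `m` such that the coefficients of `H * V` in
degrees `b, …, N` vanish. -/
noncomputable def kernelCount (m b N : ℕ) (H : PowerSeries F) : ℤ :=
  ∑ v : Fin m → F, if HasGap b N (H * seriesOf v) then 1 else 0

lemma sum_kernelCount (m b N : ℕ) :
    ∑ h : Fin N → F, kernelCount m b N (oneSeriesOf h) =
      ∑ v : Fin m → F, gapCount b N (seriesOf v) :=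
  Finset.sum_comm

lemma sum_gapCount_seriesOf_succ {m b N : ℕ} (hb : b ≤ N + 1) (hm : m ≤ N + 1) :
    ∑ v : Fin m → F, gapCount b (N + 1) (seriesOf v) - (Fintype.card F : ℤ) ^ (N + 1) =
      ∑ v : Fin m → F, gapCount b N (seriesOf v) - (Fintype.card F : ℤ) ^ N := by
  rw [← Finset.add_sum_erase _ _ (mem_univ (0 : Fin m → F)),
    ← Finset.add_sum_erase univ (fun v : Fin m → F => gapCount b N (seriesOf v)) (mem_univ 0)]
  simp only [seriesOf_zero, gapCount_zero, add_sub_cancel_left]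
  refine Finset.sum_congr rfl fun v hv => gapCount_succ hb ?_
  obtain ⟨k, hk⟩ := Function.ne_iff.mp (Finset.ne_of_mem_erase hv)
  exact ⟨k, by have := k.2; omega, by rwa [coeff_seriesOf_val]⟩

lemma sum_gapCount_cons (m b N : ℕ) :
    ∑ v : Fin (m + 1) → F, gapCount (b + 1) (b + N + 1) (seriesOf v) =
      Fintype.card F * ∑ v : Fin m → F, gapCount b (b + N) (seriesOf v) +
        (Fintype.card F - 1) * (Fintype.card F : ℤ) ^ (m + b) := by
  rw [sum_fin_succ_eq_sum_cons, ← Finset.add_sum_erase _ _ (mem_univ (0 : F)), Finset.mul_sum]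
  congr 1
  · refine Finset.sum_congr rfl fun v _ => ?_
    rw [seriesOf_cons, map_zero, zero_add, gapCount_succ_X_mul, Nat.add_sub_cancel]
  · have key : ∀ x ∈ (univ : Finset F).erase 0,
        ∑ v : Fin m → F, gapCount (b + 1) (b + N + 1) (seriesOf (Fin.cons x v : Fin (m + 1) → F)) =
          (Fintype.card F : ℤ) ^ (m + b) := by
      intro x hx
      have h0 (v : Fin m → F) : coeff 0 (seriesOf (Fin.cons x v : Fin (m + 1) → F)) ≠ 0 := by
        simpa [seriesOf_cons] using hx
      simp only [add_assoc, gapCount_of_coeff_zero_ne _ _ (h0 _)]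
      simp [pow_add]
    rw [Finset.sum_congr rfl key, Finset.sum_const, Finset.card_erase_of_mem (mem_univ _),
      Finset.card_univ, nsmul_eq_mul, Nat.cast_pred Fintype.card_pos]

lemma sum_kernelCount_sub (m b : ℕ) :
    ∑ h : Fin (b + m + 1) → F, (Fintype.card F * kernelCount m b (b + m + 1) (oneSeriesOf h) -
      kernelCount (m + 1) (b + 1) (b + m + 1) (oneSeriesOf h)) =
      (Fintype.card F - 1) ^ 2 * (Fintype.card F : ℤ) ^ (b + m) := by
  rw [Finset.sum_sub_distrib, ← Finset.mul_sum, sum_kernelCount, sum_kernelCount,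
    sum_gapCount_cons]
  have h := sum_gapCount_seriesOf_succ (F := F) (m := m) (b := b) (N := b + m)
    (by omega) (by omega)
  linear_combination (Fintype.card F : ℤ) * h

end Counting

section Kernel

open PowerSeries

variable {F : Type*} [Field F] {H : PowerSeries F} {m b : ℕ}

/-- Uniqueness of Padé approximants, read off in the top coefficients. -/
lemma coeff_mul_coeff_comm {V W : PowerSeries F}
    (hV : ∀ k, m + 1 ≤ k → coeff k V = 0) (hW : ∀ k, m + 1 ≤ k → coeff k W = 0)
    (gV : HasGap (b + 1) (b + m + 1) (H * V)) (gW : HasGap (b + 1) (b + m + 1) (H * W)) :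
    coeff b (H * V) * coeff m W = coeff b (H * W) * coeff m V := by
  have key {V W : PowerSeries F} (hW : ∀ k, m + 1 ≤ k → coeff k W = 0)
      (gV : HasGap (b + 1) (b + m + 1) (H * V)) :
      coeff (b + m) (H * V * W) = coeff b (H * V) * coeff m W := by
    rw [coeff_mul, Finset.sum_eq_single (b, m)]
    · rintro ⟨i, j⟩ hij hne
      rw [Finset.HasAntidiagonal.mem_antidiagonal] at hij
      dsimp only at hij ⊢
      rcases Nat.lt_or_ge m j with hj | hj
      · rw [hW j hj, mul_zero]
      · rw [gV i _ (by omega), zero_mul]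
        by_contra hi
        exact hne (by ext <;> dsimp only <;> omega)
    · simp
  rw [← key hW gV, ← key hV gW, mul_right_comm]

lemma eq_zero_of_top_coeff_eq_zero
    (hS : ∀ V : PowerSeries F, (∀ k, m + 1 ≤ k → coeff k V = 0) →
      HasGap (b + 1) (b + m + 1) (H * V) → coeff m V = 0 ∧ coeff b (H * V) = 0)
    (V : PowerSeries F) (hV : ∀ k, m + 1 ≤ k → coeff k V = 0)
    (gV : HasGap (b + 1) (b + m + 1) (H * V)) : V = 0 := by
  have key (j : ℕ) : ∀ V : PowerSeries F, (∀ k, m + 1 ≤ k → coeff k V = 0) →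
      HasGap (b + 1) (b + m + 1) (H * V) → ∀ k, m ≤ k + j → coeff k V = 0 := by
    induction j with
    | zero =>
      intro V hV gV k hk
      rcases Nat.eq_or_lt_of_le hk with rfl | hk
      · exact (hS V hV gV).1
      · exact hV k hk
    | succ j ih =>
      intro V hV gV k hk
      rw [← coeff_succ_X_mul]
      refine ih _ ?_ ?_ _ (by omega)
      · rintro (_ | k) hk
        · omega
        · rw [coeff_succ_X_mul]
          rcases Nat.eq_or_lt_of_le hk with hk | hk
          · obtain rfl : m = k := by omega
            exact (hS V hV gV).1
          · exact hV k (by omega)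
      · rw [mul_left_comm]
        rintro (_ | n) h1 h2
        · omega
        · rw [coeff_succ_X_mul]
          rcases Nat.eq_or_lt_of_le h1 with h1 | h1
          · obtain rfl : b = n := by omega
            exact (hS V hV gV).2
          · exact gV n (by omega) (by omega)
  ext k
  exact key m V hV gV k (by omega)

lemma kernelCount_eq_card_mul [Fintype F]
    (hH : ∃ v : Fin (m + 1) → F, v ≠ 0 ∧ HasGap (b + 1) (b + m + 1) (H * seriesOf v)) :
    kernelCount (m + 1) (b + 1) (b + m + 1) H =
      Fintype.card F * kernelCount m b (b + m + 1) H := by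
  obtain ⟨s, gs, hs⟩ : ∃ s : Fin (m + 1) → F, HasGap (b + 1) (b + m + 1) (H * seriesOf s) ∧
      ¬(coeff m (seriesOf s) = 0 ∧ coeff b (H * seriesOf s) = 0) := by
    by_contra! hS
    obtain ⟨v, hv, gv⟩ := hH
    refine hv (seriesOf_eq_zero_iff.mp (eq_zero_of_top_coeff_eq_zero (fun V hV gV => ?_) _
      (fun k hk => coeff_seriesOf_of_le v hk) gv))
    obtain ⟨w, rfl⟩ := exists_seriesOf_eq hV
    exact hS w gV
  have hlin (c : F) (v : Fin (m + 1) → F) (n : ℕ) : coeff n (H * seriesOf (c • s + v)) =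
      c * coeff n (H * seriesOf s) + coeff n (H * seriesOf v) := by
    rw [seriesOf_smul_add, mul_add, mul_left_comm, map_add, coeff_C_mul]
  have htop (c : F) (v : Fin (m + 1) → F) : coeff m (seriesOf (c • s + v)) =
      c * coeff m (seriesOf s) + coeff m (seriesOf v) := by
    rw [seriesOf_smul_add, map_add, coeff_C_mul]
  rw [kernelCount, kernelCount, Finset.sum_boole, Finset.sum_boole, ← Finset.card_univ (α := F),
    ← Nat.cast_mul, ← Finset.card_product, Nat.cast_inj]
  symm
  refine Finset.card_bij (fun p _ => p.1 • s + (Fin.snoc p.2 0 : Fin (m + 1) → F)) ?_ ?_ ?_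
  · rintro ⟨c, w⟩ hw
    simp only [mem_product, mem_univ, mem_filter, true_and] at hw ⊢
    intro n h1 h2
    rw [hlin, seriesOf_snoc_zero, gs n h1 h2, hw n (by omega) h2, mul_zero, add_zero]
  · rintro ⟨c, w⟩ hw ⟨d, z⟩ hz heq
    simp only [mem_product, mem_univ, mem_filter, true_and] at hw hz heq
    have h1 := congr_arg (fun v => coeff m (seriesOf v)) heq
    have h2 := congr_arg (fun v => coeff b (H * seriesOf v)) heq
    simp only [htop, hlin, seriesOf_snoc_zero, coeff_seriesOf_of_le _ le_rfl, hw b le_rfl (by omega),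
      hz b le_rfl (by omega), add_zero] at h1 h2
    obtain rfl : c = d := by
      by_contra hcd
      exact hs ⟨(mul_eq_mul_right_iff.mp h1).resolve_left hcd,
        (mul_eq_mul_right_iff.mp h2).resolve_left hcd⟩
    have h3 := congr_arg seriesOf (add_left_cancel heq)
    rw [seriesOf_snoc_zero, seriesOf_snoc_zero] at h3
    rw [seriesOf_injective h3]
  · intro v gv
    simp only [mem_filter, mem_univ, true_and] at gv
    have hcomm := coeff_mul_coeff_comm (fun k hk => coeff_seriesOf_of_le v hk)
      (fun k hk => coeff_seriesOf_of_le s hk) gv gs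
    obtain ⟨c, hc1, hc2⟩ : ∃ c, coeff m (seriesOf v) = c * coeff m (seriesOf s) ∧
        coeff b (H * seriesOf v) = c * coeff b (H * seriesOf s) := by
      by_cases h0 : coeff m (seriesOf s) = 0
      · have h1 : coeff b (H * seriesOf s) ≠ 0 := fun h => hs ⟨h0, h⟩
        refine ⟨coeff b (H * seriesOf v) / coeff b (H * seriesOf s), ?_, ?_⟩
        · field_simp
          linear_combination -hcomm
        · field_simp
      · refine ⟨coeff m (seriesOf v) / coeff m (seriesOf s), ?_, ?_⟩
        · field_simp
        · field_simp
          linear_combination hcomm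
    have hz : (Fin.snoc (Fin.init (v - c • s)) 0 : Fin (m + 1) → F) = v - c • s := by
      have hlast : (v - c • s) (Fin.last m) = 0 := by
        have hv := coeff_seriesOf_val v (Fin.last m)
        have hs := coeff_seriesOf_val s (Fin.last m)
        rw [Fin.val_last] at hv hs
        rw [Pi.sub_apply, Pi.smul_apply, smul_eq_mul, ← hv, ← hs, hc1, sub_self]
      conv_rhs => rw [← Fin.snoc_init_self (v - c • s), hlast]
    have hv : c • s + (v - c • s) = v := by abel
    refine ⟨(c, Fin.init (v - c • s)), ?_, ?_⟩
    · simp only [mem_product, mem_univ, mem_filter, true_and]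
      intro n h1 h2
      rw [← seriesOf_snoc_zero, hz]
      have h3 := hlin c (v - c • s) n
      rw [hv] at h3
      rcases Nat.eq_or_lt_of_le h1 with rfl | h1
      · linear_combination hc2 - h3
      · rw [gs n h1 h2, gv n h1 h2] at h3
        linear_combination -h3
    · rw [hz, hv]

lemma kernelCount_eq_one [Fintype F] {N : ℕ}
    (hH : ¬∃ v : Fin m → F, v ≠ 0 ∧ HasGap b N (H * seriesOf v)) :
    kernelCount m b N H = 1 := by
  rw [kernelCount, Finset.sum_eq_single 0]
  · rw [if_pos]
    intro n _ _
    simp [seriesOf_zero]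
  · intro v _ hv
    exact if_neg fun h => hH ⟨v, hv, h⟩
  · simp

lemma JTmat_mulVec (h : Fin (b + m + 1) → F) (w : Fin (m + 1) → F) (i : Fin (m + 1)) :
    (JTmat F (m + 1) (fun _ => b + 1) (extFin h)).mulVec w i =
      coeff (b + m + 1 - i) (oneSeriesOf h * seriesOf (w ∘ Fin.rev)) := by
  rw [coeff_mul_seriesOf, Matrix.mulVec, dotProduct, ← Equiv.sum_comp Fin.revPerm]
  refine Finset.sum_congr rfl fun k _ => ?_
  have hi := i.2
  have hk := k.2
  simp only [JTmat, Matrix.of_apply, Fin.revPerm_apply, Function.comp_apply, Fin.val_rev]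
  have hidx : ((b + 1 : ℕ) : ℤ) - (i : ℕ) + ((m + 1 - ((k : ℕ) + 1) : ℕ) : ℤ) =
      ((b + m + 1 : ℕ) : ℤ) - (i : ℕ) - (k : ℕ) := by omega
  simp only [hidx]
  split_ifs with h1 h2 h2 h3 h3
  · rw [coeff_oneSeriesOf_pos _ (by omega)]
    congr 2
    omega
  · omega
  · rw [show b + m + 1 - (i : ℕ) - k = 0 by omega, constantCoeff_oneSeriesOf]
  · omega
  · omega
  · rw [zero_mul]

lemma det_JTmat_eq_zero_iff_s9 (h : Fin (b + m + 1) → F) :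
    (JTmat F (m + 1) (fun _ => b + 1) (extFin h)).det = 0 ↔
      ∃ v : Fin (m + 1) → F, v ≠ 0 ∧
        HasGap (b + 1) (b + m + 1) (oneSeriesOf h * seriesOf v) := by
  rw [← Matrix.exists_mulVec_eq_zero_iff]
  have hrev (w : Fin (m + 1) → F) : (w ∘ Fin.rev) ∘ Fin.rev = w := by
    ext
    simp
  have hne {w : Fin (m + 1) → F} (hw : w ≠ 0) : w ∘ Fin.rev ≠ 0 := fun h => hw (by
    rw [← hrev w, h]
    rfl)
  constructor
  · rintro ⟨w, hw, h0⟩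
    refine ⟨_, hne hw, fun n h1 h2 => ?_⟩
    have := congr_fun h0 ⟨b + m + 1 - n, by omega⟩
    rw [JTmat_mulVec] at this
    rwa [show b + m + 1 - (b + m + 1 - n) = n by omega] at this
  · rintro ⟨v, hv, gv⟩
    refine ⟨_, hne hv, funext fun i => ?_⟩
    rw [JTmat_mulVec, hrev]
    have := i.2
    exact gv _ (by omega) (by omega)

end Kernel

lemma card_det_JTmat_ne_zero (F : Type*) [Field F] [Fintype F] (b m : ℕ) :
    (#{h : Fin (b + m + 1) → F | ¬(JTmat F (m + 1) (fun _ => b + 1) (extFin h)).det = 0} : ℤ) =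
      (Fintype.card F - 1) * (Fintype.card F : ℤ) ^ (b + m) := by
  have hsum := sum_kernelCount_sub (F := F) m b
  have key (h : Fin (b + m + 1) → F) :
      Fintype.card F * kernelCount m b (b + m + 1) (oneSeriesOf h) -
        kernelCount (m + 1) (b + 1) (b + m + 1) (oneSeriesOf h) =
      (Fintype.card F - 1) *
        if ¬(JTmat F (m + 1) (fun _ => b + 1) (extFin h)).det = 0 then 1 else 0 := by
    rw [det_JTmat_eq_zero_iff_s9, ite_not]
    split_ifs with hH
    · rw [kernelCount_eq_card_mul hH]
      ring
    · rw [kernelCount_eq_one hH, kernelCount_eq_one]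
      · ring
      · rintro ⟨v, hv, gv⟩
        refine hH ⟨Fin.snoc v 0, ?_, fun n h1 h2 => ?_⟩
        · rwa [ne_eq, ← seriesOf_eq_zero_iff, seriesOf_snoc_zero, seriesOf_eq_zero_iff]
        · rw [seriesOf_snoc_zero]
          exact gv n (by omega) h2
  simp only [key] at hsum
  rw [← Finset.mul_sum, Finset.sum_boole, sq, mul_assoc] at hsum
  refine mul_left_cancel₀ ?_ hsum
  have := Fintype.one_lt_card (α := F)
  omega

/-- For every rectangle `λ = (b^m)`, `P(s_λ ↦ 0) = 1/q`. -/
theorem prob_rectangle (F : Type*) [Field F] [Fintype F]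
    (b m : ℕ) (hb : 1 ≤ b) (hm : 1 ≤ m) :
    probEq F m (fun _ => b) (b + (m - 1)) 0 = 1 / (Fintype.card F : ℚ) := by
  obtain ⟨b, rfl⟩ := Nat.exists_eq_add_of_le' hb
  obtain ⟨m, rfl⟩ := Nat.exists_eq_add_of_le' hm
  rw [Nat.add_sub_cancel, add_right_comm, probEq]
  have hne := card_det_JTmat_ne_zero F b m
  have htot := Finset.card_filter_add_card_filter_not (s := univ) fun h : Fin (b + m + 1) → F =>
    (JTmat F (m + 1) (fun _ => b + 1) (extFin h)).det = 0
  rw [Finset.card_univ, Fintype.card_fun, Fintype.card_fin] at htot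
  have hq : (Fintype.card F : ℚ) ≠ 0 := Nat.cast_ne_zero.mpr Fintype.card_ne_zero
  rw [div_eq_div_iff (pow_ne_zero _ hq) hq]
  zify at htot
  have : ((#{h : Fin (b + m + 1) → F |
      (JTmat F (m + 1) (fun _ => b + 1) (extFin h)).det = 0} : ℕ) : ℤ) =
      (Fintype.card F : ℤ) ^ (b + m) := by
    linear_combination htot - hne
  have hQ := congr_arg (Int.cast : ℤ → ℚ) this
  push_cast at hQ
  rw [hQ]
  ring
end

section
/- For every staircase shape λ = δ_k = (k, k−1, …, 2, 1) with k ≥ 1, P(s_λ ↦ 0) = 1/q. -/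
open Finset Classical

open Polynomial in
/-- The pairs `(b, u)` of a monic polynomial `b` of degree `m` and a sequence `u` annihilated by
`b`, where `X` acts on sequences as the shift `LinearMap.funLeft F F Nat.succ`. -/
def recPairs (F : Type*) [Field F] (m : ℕ) : Set (F[X] × (ℕ → F)) :=
  {p | p.1.Monic ∧ p.1.natDegree = m ∧ aeval (LinearMap.funLeft F F Nat.succ) p.1 p.2 = 0}

/-- The `m × m` Hankel matrix of a sequence. -/
def hankel {F : Type*} (m : ℕ) (g : ℕ → F) : Matrix (Fin m) (Fin m) F :=
  Matrix.of fun i j => g (i + j)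

/-- Extend a tuple to a sequence by zero. -/
def extZero {F : Type*} [Zero F] {n : ℕ} (w : Fin n → F) : ℕ → F :=
  fun i => if h : i < n then w ⟨i, h⟩ else 0

theorem hankel_congr {F : Type*} {m : ℕ} {g g' : ℕ → F} (h : ∀ i < 2 * m - 1, g i = g' i) :
    hankel m g = hankel m g' := by
  ext i j
  exact h _ (by lia)

section Recurrence

variable {F : Type*} [Field F]

open Polynomial

theorem shift_pow_apply (n : ℕ) (u : ℕ → F) (j : ℕ) :
    ((LinearMap.funLeft F F Nat.succ) ^ n) u j = u (j + n) := by
  induction n generalizing u with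
  | zero => simp
  | succ n ih => rw [pow_succ, Module.End.mul_apply, ih]; rfl

theorem aeval_shift_eq_sum (b : F[X]) {m : ℕ} (hb : b.natDegree < m) (u : ℕ → F) (j : ℕ) :
    aeval (LinearMap.funLeft F F Nat.succ) b u j = ∑ i : Fin m, b.coeff i * u (j + i) := by
  rw [aeval_eq_sum_range' hb, ← Fin.sum_univ_eq_sum_range
    (fun i => b.coeff i • (LinearMap.funLeft F F Nat.succ) ^ i)]
  simp [LinearMap.sum_apply, shift_pow_apply]

theorem aeval_shift_charPoly_apply (E : LinearRecurrence F) (u : ℕ → F) (n : ℕ) :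
    aeval (LinearMap.funLeft F F Nat.succ) E.charPoly u n =
      u (n + E.order) - ∑ i, E.coeffs i * u (n + i) := by
  simp [LinearRecurrence.charPoly, aeval_monomial, shift_pow_apply, LinearMap.sum_apply,
    Module.algebraMap_end_apply]

theorem aeval_shift_charPoly_eq_zero_iff (E : LinearRecurrence F) (u : ℕ → F) :
    aeval (LinearMap.funLeft F F Nat.succ) E.charPoly u = 0 ↔ E.IsSolution u := by
  rw [funext_iff]
  refine forall_congr' fun n => ?_
  rw [aeval_shift_charPoly_apply, Pi.zero_apply, sub_eq_zero]

theorem coeff_charPoly (m : ℕ) (c : Fin m → F) (i : Fin m) :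
    (LinearRecurrence.mk m c).charPoly.coeff i = -c i := by
  rw [LinearRecurrence.charPoly, coeff_sub, finsetSum_coeff, Finset.sum_eq_single i]
  · rw [coeff_monomial_of_ne _ i.2.ne, coeff_monomial_same, zero_sub]
  · intro j _ hj
    exact coeff_monomial_of_ne _ fun h => hj (Fin.ext h.symm)
  · simp

theorem natDegree_charPoly (E : LinearRecurrence F) : E.charPoly.natDegree = E.order :=
  natDegree_eq_of_degree_eq_some E.charPoly_degree_eq_order

theorem Polynomial.Monic.eq_charPoly {b : F[X]} {m : ℕ} (hb : b.Monic) (hm : b.natDegree = m) :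
    b = (LinearRecurrence.mk m fun i => -b.coeff i).charPoly := by
  have hc := LinearRecurrence.charPoly_monic (LinearRecurrence.mk m fun i => -b.coeff i)
  have hd := natDegree_charPoly (LinearRecurrence.mk m fun i => -b.coeff i)
  replace hb : b.coeff m = 1 := hm ▸ hb
  replace hc : (LinearRecurrence.mk m fun i => -b.coeff i).charPoly.coeff m = 1 := by
    rw [← hc.coeff_natDegree, hd]
  ext i
  rcases lt_trichotomy i m with h | h | h
  · simpa using (coeff_charPoly m (fun i => -b.coeff i) ⟨i, h⟩).symm
  · rw [h, hb]
    exact hc.symm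
  · rw [coeff_eq_zero_of_natDegree_lt (hm ▸ h), coeff_eq_zero_of_natDegree_lt (by rw [hd]; exact h)]

/-- A recurrence of order `m` with initial values, as an annihilated sequence. -/
noncomputable def recPairOf (m : ℕ) (p : (Fin m → F) × (Fin m → F)) : recPairs F m :=
  ⟨((LinearRecurrence.mk m p.1).charPoly, (LinearRecurrence.mk m p.1).mkSol p.2),
    LinearRecurrence.charPoly_monic _, natDegree_charPoly _,
    (aeval_shift_charPoly_eq_zero_iff _ _).2 (LinearRecurrence.is_sol_mkSol _ _)⟩

theorem recPairOf_bijective (m : ℕ) : Function.Bijective (recPairOf (F := F) m) := by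
  constructor
  · rintro ⟨c, u⟩ ⟨c', u'⟩ h
    have h1 := congrArg (fun p => p.1.1) h
    have h2 := congrArg (fun p => p.1.2) h
    simp only [recPairOf] at h1 h2
    have hc : c = c' := funext fun i => by
      have := congrArg (fun p => p.coeff i) h1
      simpa [coeff_charPoly] using this
    subst hc
    rw [LinearRecurrence.mkSol_injective _ h2]
  · rintro ⟨⟨b, u⟩, hb, hm, hu⟩
    simp only at hb hm hu
    refine ⟨(fun i => -b.coeff i, fun i => u i), Subtype.ext (Prod.ext ?_ ?_)⟩
    · exact (hb.eq_charPoly hm).symm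
    · rw [hb.eq_charPoly hm, aeval_shift_charPoly_eq_zero_iff] at hu
      exact (LinearRecurrence.eq_mk_of_is_sol_of_eq_init' _ hu fun _ => rfl).symm

instance [Finite F] (m : ℕ) : Finite (recPairs F m) :=
  Finite.of_surjective _ (recPairOf_bijective m).2

theorem card_recPairs [Fintype F] (m : ℕ) :
    Nat.card (recPairs F m) = Fintype.card F ^ (2 * m) := by
  rw [← Nat.card_congr (Equiv.ofBijective _ (recPairOf_bijective m))]
  simp [two_mul, pow_add]

/-- Sequences with a monic annihilator of degree `m` have `|F|` times as many of degree `m + 1`. -/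
theorem card_recPairs_succ_of_exists (m : ℕ) :
    Nat.card {p : recPairs F (m + 1) // ∃ r, (r, p.1.2) ∈ recPairs F m} =
      Nat.card F * Nat.card (recPairs F m) := by
  have hex : ∀ u : ℕ → F, ∃ b : F[X], (∃ r, (r, u) ∈ recPairs F m) → (b, u) ∈ recPairs F m := by
    intro u
    by_cases h : ∃ r, (r, u) ∈ recPairs F m
    · exact h.imp fun r hr _ => hr
    · exact ⟨0, fun h' => absurd h' h⟩
  choose b₀ hb₀ using hex
  have hmem (x : F) (p : recPairs F m) :
      ((X + C x) * b₀ p.1.2 + p.1.1, p.1.2) ∈ recPairs F (m + 1) := by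
    obtain ⟨⟨b, u⟩, hb, hm, hu⟩ := p
    simp only at hb hm hu ⊢
    obtain ⟨hb', hm', hu'⟩ := hb₀ u ⟨b, hb, hm, hu⟩
    simp only at hb' hm' hu'
    have hmon : ((X + C x) * b₀ u).Monic := (monic_X_add_C x).mul hb'
    have hdeg : ((X + C x) * b₀ u).natDegree = m + 1 := by
      rw [(monic_X_add_C x).natDegree_mul hb', natDegree_X_add_C, hm', add_comm]
    refine ⟨hmon.add_of_left ?_, ?_, ?_⟩
    · rw [degree_eq_natDegree hb.ne_zero, degree_eq_natDegree hmon.ne_zero, hm, hdeg]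
      exact_mod_cast Nat.lt_succ_self m
    · rw [natDegree_add_eq_left_of_natDegree_lt (by lia), hdeg]
    · simp [hu, hu']
  rw [← Nat.card_prod]
  refine (Nat.card_congr (Equiv.ofBijective (fun p : F × recPairs F m =>
    (⟨⟨_, hmem p.1 p.2⟩, p.2.1.1, p.2.2⟩ :
      {p : recPairs F (m + 1) // ∃ r, (r, p.1.2) ∈ recPairs F m})) ⟨?_, ?_⟩)).symm
  · rintro ⟨x, ⟨⟨b, u⟩, hb, hm, hu⟩⟩ ⟨x', ⟨⟨b', u'⟩, hb', hm', hu'⟩⟩ h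
    simp only [Subtype.mk.injEq, Prod.mk.injEq] at h hb hm hu hb' hm' hu'
    obtain ⟨h, rfl⟩ := h
    obtain ⟨hb₁, hm₁, -⟩ := hb₀ u ⟨b, hb, hm, hu⟩
    simp only at hb₁ hm₁
    have hx : x = x' := by
      have h1 : C (x - x') * b₀ u + b = b' := by
        rw [C_sub]; linear_combination h
      have h2 := congrArg (fun p => p.coeff m) h1
      have e1 : b.coeff m = 1 := hm ▸ hb
      have e2 : b'.coeff m = 1 := hm' ▸ hb'
      have e3 : (b₀ u).coeff m = 1 := hm₁ ▸ hb₁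
      simp only [coeff_add, coeff_C_mul, e1, e2, e3] at h2
      linear_combination h2
    subst hx
    have : b = b' := by linear_combination h
    subst this
    rfl
  · rintro ⟨⟨⟨b, u⟩, hb, hm, hu⟩, hr⟩
    simp only at hb hm hu hr
    obtain ⟨hb₁, hm₁, hu₁⟩ := hb₀ u hr
    simp only at hb₁ hm₁ hu₁
    have hmX : (X * b₀ u).Monic := monic_X.mul hb₁
    have hdX : (X * b₀ u).natDegree = m + 1 := by
      rw [monic_X.natDegree_mul hb₁, natDegree_X, hm₁, add_comm]
    set x := (b - X * b₀ u).coeff m - 1 with hx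
    set b' := b - (X + C x) * b₀ u with hb'
    have hco : b'.coeff m = 1 := by
      have e3 : (b₀ u).coeff m = 1 := hm₁ ▸ hb₁
      rw [hb', add_mul, ← sub_sub, coeff_sub, coeff_C_mul, e3, hx]
      ring
    have hle : b'.natDegree ≤ m := by
      rw [natDegree_le_iff_coeff_eq_zero]
      intro N hN
      have e : (b₀ u).coeff N = 0 := coeff_eq_zero_of_natDegree_lt (by lia)
      rw [hb', add_mul, coeff_sub, coeff_add, coeff_C_mul, e]
      rcases (show m + 1 ≤ N from hN).eq_or_lt with rfl | hN'
      · have e1 : b.coeff (m + 1) = 1 := hm ▸ hb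
        have e2 : (X * b₀ u).coeff (m + 1) = 1 := hdX ▸ hmX
        rw [e1, e2]; ring
      · rw [coeff_eq_zero_of_natDegree_lt (by lia), coeff_eq_zero_of_natDegree_lt (by lia)]; ring
    have hmem' : (b', u) ∈ recPairs F m := by
      refine ⟨monic_of_natDegree_le_of_coeff_eq_one m hle hco, ?_, ?_⟩
      · exact le_antisymm hle (le_natDegree_of_ne_zero (by rw [hco]; exact one_ne_zero))
      · simp [hb', hu, hu₁]
    refine ⟨(x, ⟨(b', u), hmem'⟩), Subtype.ext (Subtype.ext (Prod.ext ?_ rfl))⟩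
    change (X + C x) * b₀ u + b' = b
    rw [hb']; ring

theorem exists_mem_recPairs_iff_det_hankel {m : ℕ} {b : F[X]} {u : ℕ → F}
    (h : (b, u) ∈ recPairs F (m + 1)) :
    (∃ r, (r, u) ∈ recPairs F m) ↔ (hankel (m + 1) u).det = 0 := by
  rw [← Matrix.exists_mulVec_eq_zero_iff]
  constructor
  · rintro ⟨r, hr, hm, hu⟩
    simp only at hr hm hu
    refine ⟨fun i => r.coeff i, fun h0 => ?_, funext fun n => ?_⟩
    · have h1 : r.coeff m = 1 := hm ▸ hr
      have h2 := congrFun h0 (Fin.last m)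
      simp [h1] at h2
    · have := congrFun hu n
      rw [aeval_shift_eq_sum r (m := m + 1) (by lia)] at this
      refine Eq.trans ?_ this
      simp [Matrix.mulVec, dotProduct, hankel, mul_comm]
  · rintro ⟨v, hv, hz⟩
    obtain ⟨hb, hm, hu⟩ := h
    simp only at hb hm hu
    set c : F[X] := ∑ i : Fin (m + 1), monomial i (v i) with hc
    have hco (i : Fin (m + 1)) : c.coeff i = v i := by
      rw [hc, finsetSum_coeff, Finset.sum_eq_single i]
      · exact coeff_monomial_same _ _
      · intro j _ hj
        exact coeff_monomial_of_ne _ fun h => hj (Fin.ext h.symm)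
      · simp
    have hc0 : c ≠ 0 := fun h0 => hv (funext fun i => by rw [← hco, h0]; simp)
    have hdeg : c.natDegree < m + 1 := by
      rw [natDegree_lt_iff_degree_lt hc0, hc]
      simp_rw [← C_mul_X_pow_eq_monomial]
      exact degree_sum_fin_lt v
    have hcu : aeval (LinearMap.funLeft F F Nat.succ) c u = 0 := by
      have hbc : aeval (LinearMap.funLeft F F Nat.succ) b
          (aeval (LinearMap.funLeft F F Nat.succ) c u) = 0 := by
        rw [← Module.End.mul_apply, ← map_mul, mul_comm, map_mul, Module.End.mul_apply, hu,
          map_zero]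
      rw [hb.eq_charPoly hm, aeval_shift_charPoly_eq_zero_iff] at hbc
      rw [LinearRecurrence.eq_iff_eqOn_range_order _ _ _ hbc fun n => by simp]
      intro n hn
      have hn : n < m + 1 := by simpa using hn
      have := congrFun hz ⟨n, hn⟩
      rw [aeval_shift_eq_sum c hdeg, Pi.zero_apply]
      refine Eq.trans ?_ this
      simp [Matrix.mulVec, dotProduct, hankel, hco, mul_comm]
    have hmon : (C c.leadingCoeff⁻¹ * c).Monic := by
      rw [mul_comm]; exact monic_mul_leadingCoeff_inv hc0
    refine ⟨X ^ (m - c.natDegree) * (C c.leadingCoeff⁻¹ * c), ?_, ?_, ?_⟩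
    · exact (monic_X_pow _).mul hmon
    · simp only
      rw [(monic_X_pow _).natDegree_mul hmon, natDegree_X_pow,
        natDegree_C_mul (inv_ne_zero (leadingCoeff_ne_zero.2 hc0))]
      lia
    · simp only [map_mul, Module.End.mul_apply, hcu, map_zero]

theorem recPairOf_snd_lt {m : ℕ} (p : (Fin m → F) × (Fin m → F)) (i : Fin m) :
    (recPairOf m p).1.2 i = p.2 i :=
  LinearRecurrence.mkSol_eq_init (LinearRecurrence.mk m p.1) p.2 i

theorem recPairOf_snd_add {m : ℕ} (p : (Fin m → F) × (Fin m → F)) (n : ℕ) :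
    (recPairOf m p).1.2 (n + m) = ∑ i, p.1 i * (recPairOf m p).1.2 (n + i) :=
  LinearRecurrence.is_sol_mkSol (LinearRecurrence.mk m p.1) p.2 n

theorem hankel_mulVec_recPairOf {m : ℕ} (p : (Fin m → F) × (Fin m → F)) :
    (hankel m (recPairOf m p).1.2).mulVec p.1 = fun n : Fin m => (recPairOf m p).1.2 (n + m) := by
  ext n
  rw [recPairOf_snd_add]
  simp [Matrix.mulVec, dotProduct, hankel, mul_comm]

theorem extZero_apply {n : ℕ} (w : Fin n → F) (i : Fin n) : extZero w i = w i := by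
  simp [extZero]

theorem card_hankel_ne_zero (m : ℕ) :
    Nat.card {p : recPairs F m // (hankel m p.1.2).det ≠ 0} =
      Nat.card {w : Fin (2 * m) → F // (hankel m (extZero w)).det ≠ 0} := by
  have hres (u : ℕ → F) : hankel m (extZero fun i : Fin (2 * m) => u i) = hankel m u :=
    hankel_congr fun i hi => extZero_apply _ (⟨i, by lia⟩ : Fin (2 * m))
  refine Nat.card_congr (Equiv.ofBijective
    (fun p => ⟨fun i => p.1.1.2 i, by rw [hres]; exact p.2⟩) ⟨?_, ?_⟩)
  · rintro ⟨p, hp⟩ ⟨p', hp'⟩ h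
    obtain ⟨⟨c, x⟩, rfl⟩ := (recPairOf_bijective m).2 p
    obtain ⟨⟨c', x'⟩, rfl⟩ := (recPairOf_bijective m).2 p'
    have h2 : ∀ i < 2 * m, (recPairOf m (c, x)).1.2 i = (recPairOf m (c', x')).1.2 i :=
      fun i hi => congrFun (congrArg Subtype.val h) ⟨i, hi⟩
    have hx : x = x' := funext fun i => by
      have := h2 i (by lia)
      rwa [recPairOf_snd_lt, recPairOf_snd_lt] at this
    have hH := hankel_congr (m := m) fun i hi => h2 i (by lia)
    have h3 := hankel_mulVec_recPairOf (c, x)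
    rw [show (fun n : Fin m => (recPairOf m (c, x)).1.2 (n + m)) =
      fun n : Fin m => (recPairOf m (c', x')).1.2 (n + m) from
      funext fun n => h2 _ (by lia), ← hankel_mulVec_recPairOf, hH] at h3
    have hc : c = c' := Matrix.mulVec_injective_of_isUnit
      ((Matrix.isUnit_iff_isUnit_det _).2 (isUnit_iff_ne_zero.2 hp')) h3
    subst hx hc
    rfl
  · rintro ⟨w, hw⟩
    set g := extZero w with hg
    set c : Fin m → F := (hankel m g)⁻¹.mulVec fun n => g (n + m) with hc
    have hgc : (hankel m g).mulVec c = fun n : Fin m => g (n + m) := by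
      rw [hc, Matrix.mulVec_mulVec, Matrix.mul_nonsing_inv _ (isUnit_iff_ne_zero.2 hw),
        Matrix.one_mulVec]
    have hu : ∀ i < 2 * m, (recPairOf m (c, fun i => g i)).1.2 i = g i := by
      intro i
      induction i using Nat.strong_induction_on with
      | _ i ih =>
        intro hi
        by_cases him : i < m
        · exact recPairOf_snd_lt _ ⟨i, him⟩
        · obtain ⟨n, rfl⟩ := Nat.exists_eq_add_of_le' (not_lt.1 him)
          have := congrFun hgc ⟨n, by lia⟩
          rw [recPairOf_snd_add, ← this]
          simp only [Matrix.mulVec, dotProduct, hankel, Matrix.of_apply]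
          exact Finset.sum_congr rfl fun j _ => by rw [ih _ (by lia) (by lia), mul_comm]
    refine ⟨⟨recPairOf m (c, fun i => g i), ?_⟩, Subtype.ext (funext fun i => ?_)⟩
    · rwa [hankel_congr fun i hi => hu i (by lia)]
    · exact (hu i i.2).trans (extZero_apply w i)

theorem card_hankel_eq_zero [Fintype F] (m : ℕ) :
    Nat.card {w : Fin (2 * (m + 1)) → F // (hankel (m + 1) (extZero w)).det = 0} =
      Fintype.card F * Fintype.card F ^ (2 * m) := by
  have h1 := Nat.card_congr (Equiv.sumCompl fun p : recPairs F (m + 1) =>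
    (hankel (m + 1) p.1.2).det = 0)
  have h2 := Nat.card_congr (Equiv.sumCompl fun w : Fin (2 * (m + 1)) → F =>
    (hankel (m + 1) (extZero w)).det = 0)
  have h3 := Nat.card_congr (Equiv.subtypeEquivRight fun p : recPairs F (m + 1) =>
    exists_mem_recPairs_iff_det_hankel p.2)
  have h4 := card_hankel_ne_zero (F := F) (m + 1)
  rw [Nat.card_sum, card_recPairs, ← h3, card_recPairs_succ_of_exists, card_recPairs] at h1
  rw [Nat.card_sum] at h2
  simp only [Nat.card_eq_fintype_card, Fintype.card_fun, Fintype.card_fin] at h1 h2 h4 ⊢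
  lia

end Recurrence

/-- Marginalization: constraining only the coordinates in the range of an injection does not change
densities. -/
theorem card_subtype_comp_mul {F α β : Type*} [Fintype F] [Fintype α] [Fintype β]
    {f : α → β} (hf : Function.Injective f) (P : (α → F) → Prop) :
    Nat.card {v : β → F // P (v ∘ f)} * Fintype.card F ^ Fintype.card α =
      Nat.card {w : α → F // P w} * Fintype.card F ^ Fintype.card β := by
  let e : α ⊕ {b // b ∉ Set.range f} ≃ β :=
    ((Equiv.ofInjective f hf).sumCongr (Equiv.refl _)).trans (Equiv.sumCompl (· ∈ Set.range f))
  let e' : (β → F) ≃ (α → F) × ({b // b ∉ Set.range f} → F) :=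
    (e.symm.arrowCongr (Equiv.refl F)).trans (Equiv.sumArrowEquivProdArrow _ _ _)
  have hcard : Nat.card {v : β → F // P (v ∘ f)} =
      Nat.card {w : α → F // P w} * Nat.card ({b // b ∉ Set.range f} → F) := by
    rw [← Nat.card_prod]
    refine Nat.card_congr ((e'.subtypeEquiv (q := fun p => P p.1) fun v => ?_).trans
      Equiv.prodSubtypeFstEquivSubtypeProd)
    rfl
  rw [hcard, ← Fintype.card_congr e, Fintype.card_sum, pow_add, Nat.card_fun,
    Nat.card_eq_fintype_card (α := F), Nat.card_eq_fintype_card (α := {b // b ∉ Set.range f})]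
  ring

section JacobiTrudi

variable {F : Type*} [Field F]

open PowerSeries

/-- The series of even-indexed values of `a`, with `a 0` replaced by `1`. -/
def evenSeries (a : ℕ → F) : F⟦X⟧ := mk fun i => if i = 0 then 1 else a (2 * i)

/-- The series of odd-indexed values of `a`. -/
def oddSeries (a : ℕ → F) : F⟦X⟧ := mk fun i => a (2 * i + 1)

/-- The quotient of the odd part by the even part. -/
noncomputable def quotSeries (a : ℕ → F) : F⟦X⟧ := (evenSeries a)⁻¹ * oddSeries a

theorem evenSeries_mul_quotSeries (a : ℕ → F) : evenSeries a * quotSeries a = oddSeries a := by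
  rw [quotSeries, ← mul_assoc, PowerSeries.mul_inv_cancel, one_mul]
  simp [evenSeries, ← coeff_zero_eq_constantCoeff_apply]

theorem JTmat_staircase_odd {k u : ℕ} (a : ℕ → F) (i j : Fin k) (hu : k + (j : ℕ) = 2 * u + 1) :
    JTmat F k (fun i => k - i) a i j = if (i : ℕ) ≤ u then coeff (u - i) (oddSeries a) else 0 := by
  simp only [JTmat, Matrix.of_apply, oddSeries, coeff_mk]
  split_ifs
  · congr 1; omega
  · omega
  · omega
  · omega
  · omega
  · rfl

theorem JTmat_staircase_even {k u : ℕ} (a : ℕ → F) (i j : Fin k) (hu : k + (j : ℕ) = 2 * u) :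
    JTmat F k (fun i => k - i) a i j = if (i : ℕ) ≤ u then coeff (u - i) (evenSeries a) else 0 := by
  simp only [JTmat, Matrix.of_apply, evenSeries, coeff_mk]
  split_ifs
  · omega
  · congr 1; omega
  · omega
  · rfl
  all_goals first | omega | rfl

/-- The staircase Jacobi–Trudi matrix after dividing by the even part. -/
noncomputable def reducedJT (k : ℕ) (G : F⟦X⟧) : Matrix (Fin k) (Fin k) F :=
  Matrix.of fun i j =>
    if (k + (j : ℕ)) % 2 = 1 then
      if (i : ℕ) ≤ (k + j) / 2 then coeff ((k + j) / 2 - i) G else 0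
    else if (i : ℕ) = (k + j) / 2 then 1 else 0

/-- The upper triangular Toeplitz matrix of a power series. -/
noncomputable def upperToeplitz (k : ℕ) (E : F⟦X⟧) : Matrix (Fin k) (Fin k) F :=
  Matrix.of fun i j => if i ≤ j then coeff (j - i : ℕ) E else 0

theorem det_upperToeplitz_evenSeries (k : ℕ) (a : ℕ → F) :
    (upperToeplitz k (evenSeries a)).det = 1 := by
  rw [Matrix.det_of_isUpperTriangular]
  · simp [upperToeplitz, evenSeries]
  · intro i j hij
    exact if_neg (not_le.2 hij)

theorem upperToeplitz_mul_reducedJT (k : ℕ) (a : ℕ → F) :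
    upperToeplitz k (evenSeries a) * reducedJT k (quotSeries a) =
      JTmat F k (fun i => k - i) a := by
  ext i j
  rw [Matrix.mul_apply]
  rcases Nat.even_or_odd' (k + j) with ⟨u, hu | hu⟩
  · have huk : u < k := by lia
    rw [JTmat_staircase_even a i j hu, Finset.sum_eq_single ⟨u, huk⟩]
    · have h1 : (k + (j : ℕ)) / 2 = u := by lia
      have h2 : ¬ (k + (j : ℕ)) % 2 = 1 := by lia
      simp only [reducedJT, upperToeplitz, Matrix.of_apply, h1, h2, if_false, if_true, mul_one,
        Fin.le_def]
    · intro l _ hl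
      have h2 : ¬ (k + (j : ℕ)) % 2 = 1 := by lia
      have h3 : ¬ (l : ℕ) = (k + j) / 2 := fun h => hl (Fin.ext (by simp only; lia))
      simp only [reducedJT, Matrix.of_apply, h2, h3, if_false, mul_zero]
    · simp
  · have huk : u < k := by lia
    have h1 : (k + (j : ℕ)) / 2 = u := by lia
    have h2 : (k + (j : ℕ)) % 2 = 1 := by lia
    rw [JTmat_staircase_odd a i j hu, ← evenSeries_mul_quotSeries, coeff_mul,
      Finset.Nat.sum_antidiagonal_eq_sum_range_succ
        (fun x y => coeff x (evenSeries a) * coeff y (quotSeries a))]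
    simp only [upperToeplitz, reducedJT, Matrix.of_apply, h1, h2, if_true, Fin.le_def]
    rw [Fin.sum_univ_eq_sum_range (fun l =>
      (if (i : ℕ) ≤ l then coeff (l - i) (evenSeries a) else 0) *
        if l ≤ u then coeff (u - l) (quotSeries a) else 0)]
    split_ifs with hiu
    · rw [← Finset.sum_subset (s₁ := Finset.Ico (i : ℕ) (u + 1)), Finset.sum_Ico_eq_sum_range]
      · rw [Nat.succ_eq_add_one, Nat.sub_add_comm hiu]
        refine Finset.sum_congr rfl fun l hl => ?_
        rw [Finset.mem_range] at hl
        rw [if_pos (by lia), if_pos (by lia), Nat.add_sub_cancel_left, Nat.sub_sub]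
      · intro l hl
        simp only [Finset.mem_Ico, Finset.mem_range] at hl ⊢
        lia
      · intro l _ hl
        simp only [Finset.mem_Ico, not_and, not_lt] at hl
        by_cases h : (i : ℕ) ≤ l
        · rw [if_neg (c := l ≤ u) (by have := hl h; lia), mul_zero]
        · rw [if_neg h, zero_mul]
    · refine Finset.sum_eq_zero fun l _ => ?_
      by_cases h : (i : ℕ) ≤ l
      · rw [if_neg (c := l ≤ u) (by lia), mul_zero]
      · rw [if_neg h, zero_mul]

theorem det_reducedJT_eq_zero_iff (k : ℕ) (G : F⟦X⟧) :
    (reducedJT k G).det = 0 ↔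
      (hankel ((k + 1) / 2) fun n => coeff (k - 1 - n) G).det = 0 := by
  have hcard : Fintype.card (Fin ((k + 1) / 2) ⊕ Fin (k / 2)) = Fintype.card (Fin k) := by
    simp only [Fintype.card_sum, Fintype.card_fin]; lia
  let r : Fin ((k + 1) / 2) ⊕ Fin (k / 2) → Fin k :=
    Sum.elim (fun i => ⟨i, by lia⟩) fun t => ⟨(k + 1) / 2 + t, by lia⟩
  let c : Fin ((k + 1) / 2) ⊕ Fin (k / 2) → Fin k :=
    Sum.elim (fun s => ⟨k - 1 - 2 * s, by lia⟩) fun t => ⟨2 * ((k + 1) / 2 + t) - k, by lia⟩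
  have hr : Function.Injective r := by
    rintro (x | x) (y | y) h <;>
      simp only [r, Sum.elim_inl, Sum.elim_inr, Fin.mk.injEq] at h <;>
      first | (exfalso; lia) | (congr 1; lia)
  have hc : Function.Injective c := by
    rintro (x | x) (y | y) h <;>
      simp only [c, Sum.elim_inl, Sum.elim_inr, Fin.mk.injEq] at h <;>
      first | (exfalso; lia) | (congr 1; lia)
  let er := Equiv.ofBijective r ((Fintype.bijective_iff_injective_and_card r).2 ⟨hr, hcard⟩)
  let ec := Equiv.ofBijective c ((Fintype.bijective_iff_injective_and_card c).2 ⟨hc, hcard⟩)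
  have hblock : (reducedJT k G).submatrix er ec =
      Matrix.fromBlocks (hankel ((k + 1) / 2) fun n => coeff (k - 1 - n) G) 0
        ((reducedJT k G).submatrix (r ∘ Sum.inr) (c ∘ Sum.inl)) 1 := by
    ext (x | x) (y | y)
    · have h1 : (k + (k - 1 - 2 * (y : ℕ))) % 2 = 1 := by lia
      have h2 : (x : ℕ) ≤ (k + (k - 1 - 2 * (y : ℕ))) / 2 := by lia
      have h3 : (k + (k - 1 - 2 * (y : ℕ))) / 2 - x = k - 1 - (x + y) := by lia
      simp [er, ec, r, c, reducedJT, hankel, h1, h2, h3]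
    · have h1 : ¬ (k + (2 * ((k + 1) / 2 + (y : ℕ)) - k)) % 2 = 1 := by lia
      have h2 : ¬ (x : ℕ) = (k + (2 * ((k + 1) / 2 + (y : ℕ)) - k)) / 2 := by lia
      simp only [er, ec, r, c, reducedJT, Matrix.submatrix_apply, Matrix.of_apply,
        Equiv.ofBijective_apply, Sum.elim_inl, Sum.elim_inr, h1, h2, if_false,
        Matrix.fromBlocks_apply₁₂, Matrix.zero_apply]
    · rfl
    · have h1 : ¬ (k + (2 * ((k + 1) / 2 + (y : ℕ)) - k)) % 2 = 1 := by lia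
      have h2 : (k + 1) / 2 + (x : ℕ) = (k + (2 * ((k + 1) / 2 + (y : ℕ)) - k)) / 2 ↔ x = y := by
        rw [Fin.ext_iff]; lia
      simp only [er, ec, r, c, reducedJT, Matrix.submatrix_apply, Matrix.of_apply,
        Equiv.ofBijective_apply, Sum.elim_inr, h1, h2, if_false,
        Matrix.fromBlocks_apply₂₂, Matrix.one_apply]
  rw [← not_iff_not, ← ne_eq, ← ne_eq, ← isUnit_iff_ne_zero, ← isUnit_iff_ne_zero,
    ← Matrix.isUnit_iff_isUnit_det, ← Matrix.isUnit_submatrix_equiv er ec, hblock,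
    Matrix.isUnit_iff_isUnit_det, Matrix.det_fromBlocks_zero₁₂, Matrix.det_one, mul_one]

theorem det_JTmat_staircase_eq_zero_iff (k : ℕ) (a : ℕ → F) :
    (JTmat F k (fun i => k - i) a).det = 0 ↔
      (hankel ((k + 1) / 2) fun n => coeff (k - 1 - n) (quotSeries a)).det = 0 := by
  rw [← upperToeplitz_mul_reducedJT, Matrix.det_mul, det_upperToeplitz_evenSeries, one_mul,
    det_reducedJT_eq_zero_iff]

/-- Replace the odd-indexed values of an assignment by the coefficients of `quotSeries`. -/
noncomputable def oddQuot (N : ℕ) (b : Fin N → F) : Fin N → F := fun n =>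
  if (n : ℕ) % 2 = 0 then coeff ((n : ℕ) / 2) (quotSeries (extFin b)) else b n

theorem oddQuot_injective (N : ℕ) : Function.Injective (oddQuot (F := F) N) := by
  intro b b' h
  have hodd (n : Fin N) (hn : ¬ (n : ℕ) % 2 = 0) : b n = b' n := by
    simpa [oddQuot, hn] using congrFun h n
  have hE : evenSeries (extFin b) = evenSeries (extFin b') := by
    ext i
    simp only [evenSeries, coeff_mk, extFin]
    split_ifs
    · rfl
    · exact hodd _ (by simp only; lia)
    · rfl
  ext n
  by_cases hn : (n : ℕ) % 2 = 0
  · have hO (b : Fin N → F) : b n = coeff ((n : ℕ) / 2) (oddSeries (extFin b)) := by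
      simp only [oddSeries, coeff_mk, extFin]
      rw [dif_pos (by lia)]
      congr 1
      exact Fin.ext (by simp only; lia)
    rw [hO b, hO b', ← evenSeries_mul_quotSeries, ← evenSeries_mul_quotSeries, hE, coeff_mul,
      coeff_mul]
    refine Finset.sum_congr rfl fun p hp => ?_
    have hp2 := Finset.HasAntidiagonal.mem_antidiagonal.1 hp
    have := congrFun h ⟨2 * p.2, by lia⟩
    simp only [oddQuot, Nat.mul_mod_right, if_true, Nat.mul_div_cancel_left _ zero_lt_two] at this
    rw [this]
  · exact hodd n hn

theorem card_det_JTmat_staircase [Fintype F] (k : ℕ) (hk : 1 ≤ k) :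
    Fintype.card F * Nat.card {b : Fin (k + (k - 1)) → F //
      (JTmat F k (fun i => k - i) (extFin b)).det = 0} = Fintype.card F ^ (k + (k - 1)) := by
  obtain ⟨m, hm⟩ : ∃ m, (k + 1) / 2 = m + 1 := ⟨(k + 1) / 2 - 1, by lia⟩
  let f : Fin (2 * m + 1) → Fin (k + (k - 1)) := fun n => ⟨2 * (k - 1 - n), by lia⟩
  have hf : Function.Injective f := fun x y h => by
    simp only [f, Fin.mk.injEq] at h
    exact Fin.ext (by lia)
  let g : Fin (2 * m + 1) → Fin (2 * (m + 1)) := Fin.castLE (by lia)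
  have hg : Function.Injective g := Fin.castLE_injective _
  have hΦ : Nat.card {b : Fin (k + (k - 1)) → F //
      (JTmat F k (fun i => k - i) (extFin b)).det = 0} =
      Nat.card {v : Fin (k + (k - 1)) → F // (hankel (m + 1) (extZero (v ∘ f))).det = 0} := by
    refine Nat.card_congr ((Equiv.ofBijective _
      (Finite.injective_iff_bijective.1 (oddQuot_injective _))).subtypeEquiv fun b => ?_)
    rw [det_JTmat_staircase_eq_zero_iff, hm]
    rw [hankel_congr (g' := extZero (oddQuot _ b ∘ f))]
    · rfl
    · intro i hi
      rw [extZero, dif_pos (by lia)]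
      simp [oddQuot, f]
  have hres : Nat.card {v : Fin (2 * (m + 1)) → F // (hankel (m + 1) (extZero (v ∘ g))).det = 0} =
      Nat.card {w : Fin (2 * (m + 1)) → F // (hankel (m + 1) (extZero w)).det = 0} := by
    refine Nat.card_congr (Equiv.subtypeEquivRight fun v => ?_)
    rw [hankel_congr (g' := extZero v)]
    intro i hi
    rw [extZero, extZero, dif_pos (by lia), dif_pos (by lia)]
    rfl
  have h1 := card_subtype_comp_mul hf fun w : Fin (2 * m + 1) → F =>
    (hankel (m + 1) (extZero w)).det = 0
  have h2 := card_subtype_comp_mul hg fun w : Fin (2 * m + 1) → F =>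
    (hankel (m + 1) (extZero w)).det = 0
  rw [hres, card_hankel_eq_zero] at h2
  rw [← hΦ] at h1
  simp only [Fintype.card_fin] at h1 h2
  have hq : 0 < Fintype.card F := Fintype.card_pos
  set Z := Nat.card {w : Fin (2 * m + 1) → F // (hankel (m + 1) (extZero w)).det = 0}
  have hZ : Fintype.card F * Z = Fintype.card F ^ (2 * m + 1) := by
    refine Nat.eq_of_mul_eq_mul_right (pow_pos hq (2 * m + 1)) ?_
    rw [show 2 * (m + 1) = 2 * m + 1 + 1 by ring, pow_succ _ (2 * m + 1)] at h2
    linear_combination -h2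
  refine Nat.eq_of_mul_eq_mul_right (pow_pos hq (2 * m + 1)) ?_
  rw [mul_assoc, h1, ← mul_assoc, hZ, mul_comm]

end JacobiTrudi

/-- For every staircase `λ = δ_k = (k, k−1, …, 2, 1)`, `P(s_λ ↦ 0) = 1/q`. -/
theorem prob_staircase (F : Type*) [Field F] [Fintype F] (k : ℕ) (hk : 1 ≤ k) :
    probEq F k (fun i => k - i) (k + (k - 1)) 0 = 1 / (Fintype.card F : ℚ) := by
  have hq : (Fintype.card F : ℚ) ≠ 0 := Nat.cast_ne_zero.2 Fintype.card_ne_zero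
  have h := card_det_JTmat_staircase (F := F) k hk
  rw [Nat.card_eq_fintype_card, Fintype.card_subtype] at h
  rw [probEq, div_eq_div_iff (pow_ne_zero _ hq) hq, one_mul, mul_comm]
  exact_mod_cast h
end
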